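/- arXiv:1704.08398 — 4 statements merged into one kernel-verified Lean document; each statement's English description precedes it below -/
import Mathlib

section
/- There exists a constant C > 0 such that for all λ > 0, μ > 0 and integers n ≥ 1 with R = λ/μ < n and ρ := R/n ≥ 1/2, and for every integer k > n with z := δ(k − R), the relative tail error satisfies |P(X̃(∞) ≥ z)/P(Y_S(∞) ≥ z) − 1| ≤ (1−ρ)/ρ + 2(1−ρ)²/ρ + δ² + C·e^{ζ²}·(δ² + δ(1−ρ)/ρ + (1−ρ)²/ρ²) + C·e^{2ζ²}·ζ²·(δ² + δ(1−ρ)/ρ + (1−ρ)²/ρ²)·min{max(z, 1), δ^{−2}(1/|ζ| + δ)³}. -/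
open MeasureTheory Set


noncomputable def ecF (θ τ : ℝ) : ℝ := (1 + θ) * Real.log (1 + τ) - τ
noncomputable def ecG (θ τ : ℝ) : ℝ := 2 * (2 + θ) * τ / (2 + τ) - 4 * (Real.log (2 + τ) - Real.log 2)

lemma ecF_deriv (θ τ : ℝ) (h : 0 ≤ τ) : HasDerivAt (ecF θ) ((θ - τ) / (1 + τ)) τ := by
  have h1 : (1 + τ) ≠ 0 := by positivity
  have := ((((hasDerivAt_id τ).const_add 1).log h1).const_mul (1 + θ)).sub (hasDerivAt_id τ)
  refine this.congr_deriv ?_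
  simp only [id]
  field_simp
  ring

lemma ecG_deriv (θ τ : ℝ) (h : 0 ≤ τ) : HasDerivAt (ecG θ) (4 * (θ - τ) / (2 + τ) ^ 2) τ := by
  have h1 : (2 + τ) ≠ 0 := by positivity
  have := (((hasDerivAt_id τ).const_mul (2 * (2 + θ))).div ((hasDerivAt_id τ).const_add 2) h1).sub
    (((((hasDerivAt_id τ).const_add 2).log h1).sub_const (Real.log 2)).const_mul 4)
  refine this.congr_deriv ?_
  simp only [id]
  field_simp
  ring

/-- comparison by derivatives -/
lemma ec_mono {u u' : ℝ → ℝ} {a b : ℝ} (hab : a ≤ b) (hd : ∀ x ∈ Icc a b, HasDerivAt u (u' x) x)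
    (hn : ∀ x ∈ Icc a b, 0 ≤ u' x) : u a ≤ u b := by
  have : MonotoneOn u (Icc a b) := by
    apply monotoneOn_of_deriv_nonneg (convex_Icc a b)
    · exact fun x hx => (hd x hx).continuousAt.continuousWithinAt
    · exact fun x hx => (hd x (interior_subset hx)).differentiableAt.differentiableWithinAt
    · intro x hx
      rw [(hd x (interior_subset hx)).deriv]; exact hn x (interior_subset hx)
  exact this (left_mem_Icc.2 hab) (right_mem_Icc.2 hab) hab

lemma ecF_zero (θ : ℝ) : ecF θ 0 = 0 := by simp [ecF]
lemma ecG_zero (θ : ℝ) : ecG θ 0 = 0 := by simp [ecG]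

lemma ecD_id (θ τ : ℝ) (h : 0 ≤ τ) : 4 * (θ - τ) / (2 + τ) ^ 2 - (θ - τ) / (1 + τ)
    = (τ - θ) * τ ^ 2 / ((1 + τ) * (2 + τ) ^ 2) := by
  have h1 : (2 + τ) ≠ 0 := by positivity
  have h2 : (1 + τ) ≠ 0 := by positivity
  field_simp
  ring

lemma ecD_deriv (θ τ : ℝ) (h : 0 ≤ τ) : HasDerivAt (fun t => ecG θ t - ecF θ t)
    ((τ - θ) * τ ^ 2 / ((1 + τ) * (2 + τ) ^ 2)) τ := by
  rw [← ecD_id θ τ h]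
  exact (ecG_deriv θ τ h).sub (ecF_deriv θ τ h)

lemma ec_den (τ : ℝ) (h : 0 ≤ τ) : 4 ≤ (1 + τ) * (2 + τ) ^ 2 := by
  nlinarith [mul_nonneg h h, mul_nonneg (mul_nonneg h h) h]

lemma ecD_nonpos (θ τ : ℝ) (h : 0 ≤ τ) (h2 : τ ≤ θ) : ecG θ τ ≤ ecF θ τ := by
  have := ec_mono (u := fun t => -(ecG θ t - ecF θ t)) h
    (fun x hx => (ecD_deriv θ x hx.1).neg) (fun x hx => by
      have := hx.1
      have h3 : x - θ ≤ 0 := by linarith [hx.2]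
      rw [neg_nonneg]
      apply div_nonpos_of_nonpos_of_nonneg
      · exact mul_nonpos_of_nonpos_of_nonneg h3 (sq_nonneg x)
      · positivity)
  simp only [ecF_zero, ecG_zero] at this
  linarith

lemma ecD_lower_aux (θ τ : ℝ) (h : 0 ≤ τ) (h2 : τ ≤ θ) : - θ ^ 4 / 4 ≤ ecG θ τ - ecF θ τ := by
  have := ec_mono (u := fun t => (ecG θ t - ecF θ t) + θ ^ 3 / 4 * t) h
    (fun x hx => (ecD_deriv θ x hx.1).add ((hasDerivAt_id x).const_mul _)) (fun x hx => by
      have h0 := hx.1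
      have hd := ec_den x h0
      have h3 : 0 ≤ θ - x := by linarith [hx.2]
      have h4 : (θ - x) * x ^ 2 ≤ θ ^ 3 := by
        have : x ^ 2 ≤ θ ^ 2 := by nlinarith
        nlinarith [sq_nonneg x, sq_nonneg θ]
      have : (x - θ) * x ^ 2 / ((1 + x) * (2 + x) ^ 2) ≥ - (θ ^ 3 / 4) := by
        rw [ge_iff_le, le_div_iff₀ (by linarith)]
        have : 0 ≤ θ ^ 3 := le_trans (mul_nonneg h3 (sq_nonneg x)) h4
        nlinarith
      linarith)
  simp only [ecF_zero, ecG_zero] at this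
  have h5 : 0 ≤ θ := h.trans h2
  have : θ ^ 3 / 4 * τ ≤ θ ^ 4 / 4 := by
    have : θ ^ 3 * τ ≤ θ ^ 3 * θ := by gcongr
    nlinarith
  linarith

lemma ecD_lower (θ τ : ℝ) (hθ : 0 ≤ θ) (h : 0 ≤ τ) : - θ ^ 4 / 4 ≤ ecG θ τ - ecF θ τ := by
  rcases le_total τ θ with h2 | h2
  · exact ecD_lower_aux θ τ h h2
  · refine (ecD_lower_aux θ θ hθ le_rfl).trans ?_
    exact ec_mono (u := fun t => (ecG θ t - ecF θ t)) h2
      (fun x hx => (ecD_deriv θ x (hθ.trans hx.1))) (fun x hx => by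
        have := hx.1
        have : 0 ≤ x - θ := by linarith
        have : 0 ≤ x := by linarith
        positivity)

lemma ecD_upper (θ τ : ℝ) (hθ : 0 ≤ θ) (h : θ ≤ τ) :
    ecG θ τ - ecF θ τ ≤ (τ - θ) ^ 2 * τ ^ 2 / 8 := by
  have := ec_mono (u := fun t => (t - θ) ^ 2 * t ^ 2 / 8 - (ecG θ t - ecF θ t)) h
    (fun x hx => (((((hasDerivAt_id x).sub_const θ).pow 2).mul ((hasDerivAt_id x).pow 2)).div_const 8).sub
      (ecD_deriv θ x (hθ.trans hx.1))) (fun x hx => by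
        have h1 : 0 ≤ x - θ := by linarith [hx.1]
        have h2 : 0 ≤ x := by linarith [hx.1]
        have hd := ec_den x h2
        have : (x - θ) * x ^ 2 / ((1 + x) * (2 + x) ^ 2) ≤ (x - θ) * x ^ 2 / 4 := by
          apply div_le_div_of_nonneg_left (by positivity) (by norm_num) hd
        have h3 : 0 ≤ (x - θ) ^ 2 * x := by positivity
        simp [id]
        nlinarith)
  have h0 := ecD_nonpos θ θ hθ le_rfl
  simp only [sub_self] at this
  linarith

lemma ecG_gauss (θ τ : ℝ) (hθ : 0 ≤ θ) (h : θ ≤ τ) (h4 : τ ≤ 4) :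
    ecG θ τ ≤ ecG θ θ - (τ - θ) ^ 2 / 18 := by
  have := ec_mono (u := fun t => - ecG θ t - (t - θ) ^ 2 / 18) h
    (fun x hx => ((ecG_deriv θ x (hθ.trans hx.1)).neg).sub
      ((((hasDerivAt_id x).sub_const θ).pow 2).div_const 18)) (fun x hx => by
        have h1 : 0 ≤ x - θ := by linarith [hx.1]
        have h2 : 0 ≤ x := by linarith [hx.1]
        have h3 : (x - θ) / 9 ≤ 4 * (x - θ) / (2 + x) ^ 2 := by
          rw [div_le_div_iff₀ (by norm_num) (by positivity)]
          have : x ≤ 4 := hx.2.trans h4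
          have : (2 + x) ^ 2 ≤ 36 := by nlinarith
          nlinarith
        have h5 : 4 * (θ - x) / (2 + x) ^ 2 = - (4 * (x - θ) / (2 + x) ^ 2) := by ring
        simp [id]
        rw [h5]
        linarith)
  simp only [sub_self] at this
  linarith

lemma ecF_gauss (θ τ : ℝ) (hθ : 0 ≤ θ) (h : θ ≤ τ) :
    ecF θ θ - (τ - θ) ^ 2 / 2 ≤ ecF θ τ := by
  have := ec_mono (u := fun t => ecF θ t + (t - θ) ^ 2 / 2) h
    (fun x hx => ((ecF_deriv θ x (hθ.trans hx.1))).add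
      ((((hasDerivAt_id x).sub_const θ).pow 2).div_const 2)) (fun x hx => by
        have h1 : 0 ≤ x - θ := by linarith [hx.1]
        have h2 : 0 ≤ x := by linarith [hx.1]
        have h3 : (x - θ) / (1 + x) ≤ x - θ := div_le_self h1 (by linarith)
        have h5 : (θ - x) / (1 + x) = - ((x - θ) / (1 + x)) := by ring
        simp [id]
        rw [h5]
        linarith)
  simp only [sub_self] at this
  linarith

lemma ecG_end (θ : ℝ) (h0 : 0 ≤ θ) (h1 : θ ≤ 1) : ecG θ (2 + 2 * θ) ≤ - (1 / 3) := by
  have e1 : ecG θ (2 + 2 * θ) = 2 + 2 * θ - 4 * Real.log (2 + θ) := by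
    unfold ecG
    rw [show 2 + (2 + 2 * θ) = 2 * (2 + θ) by ring, Real.log_mul (by norm_num) (by positivity)]
    field_simp
    ring
  have e3 : 1 + 9 / 100 ≤ Real.log 3 := by
    have := Real.one_sub_inv_le_log_of_pos (x := 3 / Real.exp 1) (by positivity)
    rw [Real.log_div (by norm_num) (by positivity), Real.log_exp, inv_div] at this
    have := Real.exp_one_lt_d9
    linarith
  have e2 : Real.log 3 + 1 - 3 / (2 + θ) ≤ Real.log (2 + θ) := by
    have := Real.one_sub_inv_le_log_of_pos (x := (2 + θ) / 3) (by positivity)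
    rw [Real.log_div (by positivity) (by norm_num), inv_div] at this
    linarith
  have e4 : 2 * θ - 2 + 12 / (2 + θ) ≤ 4 := by
    have : 12 / (2 + θ) ≤ 6 - 2 * θ := by
      rw [div_le_iff₀ (by positivity)]
      nlinarith
    linarith
  have : 12 / (2 + θ) = 4 * (3 / (2 + θ)) := by ring
  rw [e1]
  linarith

lemma ec_int (R : ℝ) (hR : 0 < R) (n : ℕ) :
    IntegrableOn (fun τ : ℝ => (1 + τ) ^ n * Real.exp (-R * τ)) (Ioi 0) := by
  have hc : Continuous (fun τ : ℝ => (1 + τ) ^ n * Real.exp (-R * τ)) := by fun_prop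
  apply integrable_of_isBigO_exp_neg (b := R / 2) (by positivity) hc.continuousOn
  apply Asymptotics.IsBigO.of_bound ((n.factorial : ℝ) / (R / 2) ^ n * Real.exp (R / 2))
  filter_upwards [Filter.eventually_ge_atTop 0] with τ hτ
  have h1 := Real.pow_div_factorial_le_exp (R / 2 * (1 + τ)) (by positivity) n
  rw [Real.norm_of_nonneg (by positivity), Real.norm_of_nonneg (by positivity)]
  rw [mul_pow, div_le_iff₀ (by positivity)] at h1
  have h2 : (1 + τ) ^ n ≤ (n.factorial : ℝ) / (R / 2) ^ n * Real.exp (R / 2 * (1 + τ)) := by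
    rw [div_mul_eq_mul_div, le_div_iff₀ (by positivity)]
    linarith
  calc (1 + τ) ^ n * Real.exp (-R * τ)
      ≤ (n.factorial : ℝ) / (R / 2) ^ n * Real.exp (R / 2 * (1 + τ)) * Real.exp (-R * τ) := by gcongr
    _ = (n.factorial : ℝ) / (R / 2) ^ n * (Real.exp (R / 2 * (1 + τ)) * Real.exp (-R * τ)) := by ring
    _ = (n.factorial : ℝ) / (R / 2) ^ n * (Real.exp (R / 2) * Real.exp (-(R / 2) * τ)) := by
        rw [← Real.exp_add, ← Real.exp_add]; congr 2; ring
    _ = _ := by ring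

noncomputable def ecB (R : ℝ) (n : ℕ) : ℝ := R * ∫ τ in Ioi (0:ℝ), (1 + τ) ^ n * Real.exp (-R * τ)

lemma ec_tendsto (R : ℝ) (hR : 0 < R) (n : ℕ) :
    Filter.Tendsto (fun τ : ℝ => (1 + τ) ^ n * Real.exp (-R * τ)) Filter.atTop (nhds 0) := by
  have h := Real.tendsto_pow_mul_exp_neg_atTop_nhds_zero n
  have h2 : Filter.Tendsto (fun τ : ℝ => R * (1 + τ)) Filter.atTop Filter.atTop :=
    (Filter.tendsto_atTop_add_const_left _ 1 Filter.tendsto_id).const_mul_atTop hR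
  have h3 := (h.comp h2).const_mul (Real.exp R / R ^ n)
  rw [mul_zero] at h3
  refine h3.congr fun τ => ?_
  simp only [Function.comp]
  rw [mul_pow, show -R * τ = R + -(R * (1 + τ)) by ring, Real.exp_add]
  field_simp

lemma ecB_zero (R : ℝ) (hR : 0 < R) : ecB R 0 = 1 := by
  unfold ecB
  simp only [pow_zero, one_mul]
  rw [integral_exp_mul_Ioi (by linarith)]
  simp
  field_simp

lemma ecB_succ (R : ℝ) (hR : 0 < R) (n : ℕ) : ecB R (n + 1) = 1 + (n + 1) / R * ecB R n := by
  have hd : ∀ x ∈ Ici (0:ℝ), HasDerivAt (fun τ : ℝ => (1 + τ) ^ (n + 1) * Real.exp (-R * τ))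
      ((n + 1) * ((1 + x) ^ n * Real.exp (-R * x)) - R * ((1 + x) ^ (n + 1) * Real.exp (-R * x))) x := by
    intro x _
    have := (((hasDerivAt_id x).const_add 1).pow (n + 1)).mul (((hasDerivAt_id x).const_mul (-R)).exp)
    refine this.congr_deriv ?_
    simp [id]
    ring
  have hi1 := (ec_int R hR n).const_mul ((n:ℝ) + 1)
  have hi2 := (ec_int R hR (n + 1)).const_mul R
  have := integral_Ioi_of_hasDerivAt_of_tendsto' hd (hi1.sub hi2) (ec_tendsto R hR (n + 1))
  rw [integral_sub hi1 hi2, integral_const_mul, integral_const_mul] at this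
  simp at this
  unfold ecB
  simp only [neg_mul]
  field_simp
  linarith

lemma ecB_ge_one (R : ℝ) (hR : 0 < R) (n : ℕ) : 1 ≤ ecB R n := by
  induction n with
  | zero => rw [ecB_zero R hR]
  | succ n ih =>
    rw [ecB_succ R hR]
    have : 0 ≤ (n + 1) / R * ecB R n := by positivity
    linarith

/-- the exponent form -/
lemma ecF_exp (R θ τ : ℝ) (n : ℕ) (hn : (n:ℝ) = R * (1 + θ)) (hτ : 0 ≤ τ) :
    (1 + τ) ^ n * Real.exp (-R * τ) = Real.exp (R * ecF θ τ) := by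
  have h1 : (0:ℝ) < 1 + τ := by positivity
  rw [← Real.exp_log (pow_pos h1 n), ← Real.exp_add, Real.log_pow, hn]
  congr 1
  unfold ecF
  ring

lemma ecB_eq (R θ : ℝ) (n : ℕ) (hn : (n:ℝ) = R * (1 + θ)) :
    ecB R n = R * ∫ τ in Ioi (0:ℝ), Real.exp (R * ecF θ τ) := by
  unfold ecB
  congr 1
  exact setIntegral_congr_fun measurableSet_Ioi fun x hx => ecF_exp R θ x n hn (le_of_lt hx)

lemma ecF_int (R θ : ℝ) (hR : 0 < R) (n : ℕ) (hn : (n:ℝ) = R * (1 + θ)) :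
    IntegrableOn (fun τ => Real.exp (R * ecF θ τ)) (Ioi 0) :=
  (ec_int R hR n).congr_fun (fun x hx => ecF_exp R θ x n hn (le_of_lt hx)) measurableSet_Ioi

lemma ecG_cont (R θ : ℝ) : ContinuousOn (fun τ => Real.exp (R * ecG θ τ)) (Ici 0) := fun x hx =>
  (((ecG_deriv θ x hx).continuousAt.const_mul R).rexp).continuousWithinAt

lemma ecF_cont (R θ : ℝ) : ContinuousOn (fun τ => Real.exp (R * ecF θ τ)) (Ici 0) := fun x hx =>
  (((ecF_deriv θ x hx).continuousAt.const_mul R).rexp).continuousWithinAt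

lemma ecG_ii (R θ a b : ℝ) (ha : 0 ≤ a) (hb : 0 ≤ b) :
    IntervalIntegrable (fun τ => Real.exp (R * ecG θ τ)) volume a b :=
  ((ecG_cont R θ).mono (fun x hx => (le_min ha hb).trans hx.1)).intervalIntegrable

lemma ecF_ii (R θ a b : ℝ) (ha : 0 ≤ a) (hb : 0 ≤ b) :
    IntervalIntegrable (fun τ => Real.exp (R * ecF θ τ)) volume a b :=
  ((ecF_cont R θ).mono (fun x hx => (le_min ha hb).trans hx.1)).intervalIntegrable

/-- `B` dominates finite integrals. -/
lemma ecB_ge (R θ a b : ℝ) (hR : 0 < R) (n : ℕ) (hn : (n:ℝ) = R * (1 + θ)) (ha : 0 ≤ a) (hab : a ≤ b) :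
    R * ∫ τ in a..b, Real.exp (R * ecF θ τ) ≤ ecB R n := by
  rw [ecB_eq R θ n hn, intervalIntegral.integral_of_le hab]
  apply mul_le_mul_of_nonneg_left _ hR.le
  apply setIntegral_mono_set (ecF_int R θ hR n hn)
  · exact Filter.Eventually.of_forall fun _ => (Real.exp_pos _).le
  · exact Filter.Eventually.of_forall fun _ hx => lt_of_le_of_lt ha hx.1

/-- crude lower bound for `B` around the peak. -/
lemma ecB_peak (R θ : ℝ) (hR : 0 < R) (hθ : 0 ≤ θ) (n : ℕ) (hn : (n:ℝ) = R * (1 + θ)) :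
    Real.sqrt R * Real.exp (R * ecF θ θ) * Real.exp (-(1 / 2)) ≤ ecB R n := by
  have hs : 0 < Real.sqrt R := Real.sqrt_pos.2 hR
  refine le_trans ?_ (ecB_ge R θ θ (θ + 1 / Real.sqrt R) hR n hn hθ (by simp))
  have hle : θ ≤ θ + 1 / Real.sqrt R := by simp
  have := intervalIntegral.integral_mono_on (μ := volume) (f := fun _ => Real.exp (R * ecF θ θ) * Real.exp (-(1 / 2)))
    (g := fun τ => Real.exp (R * ecF θ τ)) hle (by simp)
    (ecF_ii R θ _ _ hθ (by positivity)) (fun x hx => by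
      rw [← Real.exp_add]
      apply Real.exp_le_exp.2
      have h1 := ecF_gauss θ x hθ hx.1
      have h2 : (x - θ) ^ 2 ≤ 1 / R := by
        have h3 : 0 ≤ x - θ := by linarith [hx.1]
        have h4 : x - θ ≤ 1 / Real.sqrt R := by linarith [hx.2]
        calc (x - θ) ^ 2 ≤ (1 / Real.sqrt R) ^ 2 := by gcongr
          _ = 1 / R := by rw [div_pow, Real.sq_sqrt hR.le]; simp
      have h5 : R * (x - θ) ^ 2 ≤ 1 := by
        calc R * (x - θ) ^ 2 ≤ R * (1 / R) := by gcongr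
          _ = 1 := by field_simp
      nlinarith)
  rw [intervalIntegral.integral_const] at this
  have h6 : R * ((θ + 1 / Real.sqrt R - θ) • (Real.exp (R * ecF θ θ) * Real.exp (-(1 / 2))))
      = Real.sqrt R * Real.exp (R * ecF θ θ) * Real.exp (-(1 / 2)) := by
    rw [smul_eq_mul]
    nth_rewrite 1 [← Real.mul_self_sqrt hR.le]
    field_simp
    ring
  rw [← h6]
  gcongr

lemma ec_x_exp (x : ℝ) (hx : 0 < x) : Real.exp (-x) ≤ 1 / x := by
  rw [Real.exp_neg, one_div]
  apply inv_anti₀ hx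
  linarith [Real.add_one_le_exp x]

/-- tail of `B`. -/
lemma ecB_tail (R θ : ℝ) (hR : 0 < R) (hθ : 0 ≤ θ) (h1 : θ ≤ 1) (n : ℕ) (hn : (n:ℝ) = R * (1 + θ)) :
    ecB R n - R * ∫ τ in (0:ℝ)..(2 + 2 * θ), Real.exp (R * ecF θ τ) ≤ 6 / R := by
  have hL : (0:ℝ) ≤ 2 + 2 * θ := by positivity
  have hfint := ecF_int R θ hR n hn
  have hfintL : IntegrableOn (fun τ => Real.exp (R * ecF θ τ)) (Ioi (2 + 2 * θ)) :=
    hfint.mono_set (Ioi_subset_Ioi hL)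
  have hsplit : ∫ τ in Ioi (0:ℝ), Real.exp (R * ecF θ τ)
      = (∫ τ in (0:ℝ)..(2 + 2 * θ), Real.exp (R * ecF θ τ))
        + ∫ τ in Ioi (2 + 2 * θ), Real.exp (R * ecF θ τ) := by
    rw [intervalIntegral.integral_Ioi_sub_Ioi hfint hL |>.symm]; ring
  have hend : ecF θ (2 + 2 * θ) ≤ - (2 / 7) := by
    have e1 : Real.log (1 + (2 + 2 * θ)) ≤ 5 / 7 + 1 := by
      have h := Real.log_le_sub_one_of_pos (x := (1 + (2 + 2 * θ)) / Real.exp 2) (by positivity)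
      rw [Real.log_div (by positivity) (by positivity), Real.log_exp] at h
      have h7 : 7 ≤ Real.exp 2 := by
        have := Real.exp_one_gt_d9
        rw [show (2:ℝ) = 1 + 1 by norm_num, Real.exp_add]
        nlinarith
      have : (1 + (2 + 2 * θ)) / Real.exp 2 ≤ 5 / 7 := by
        apply div_le_div₀ <;> linarith
      linarith
    unfold ecF
    nlinarith
  have hle : ∫ τ in Ioi (2 + 2 * θ), Real.exp (R * ecF θ τ) ≤
      ∫ τ in Ioi (2 + 2 * θ), Real.exp (R * (-(2 / 7) + 3 / 5 * (2 + 2 * θ))) * Real.exp (-(3 / 5 * R) * τ) := by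
    apply setIntegral_mono_on hfintL _ measurableSet_Ioi
    · intro x hx
      have hx' : 2 + 2 * θ ≤ x := le_of_lt hx
      rw [← Real.exp_add]
      apply Real.exp_le_exp.2
      have h3 := ec_mono (u := fun t => - ecF θ t - 3 / 5 * t) hx'
        (fun y hy => ((ecF_deriv θ y (hL.trans hy.1)).neg).sub ((hasDerivAt_id y).const_mul _)) (fun y hy => by
          have h4 := hy.1
          have : 3 / 5 ≤ (y - θ) / (1 + y) := by
            rw [div_le_div_iff₀ (by norm_num) (by linarith)]
            linarith
          have h5 : (θ - y) / (1 + y) = - ((y - θ) / (1 + y)) := by ring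
          rw [h5]
          linarith)
      nlinarith
    · exact (integrableOn_exp_mul_Ioi (by linarith) _).const_mul _
  rw [integral_const_mul, integral_exp_mul_Ioi (by linarith)] at hle
  have h8 : Real.exp (R * (-(2 / 7) + 3 / 5 * (2 + 2 * θ))) * (-Real.exp (-(3 / 5 * R) * (2 + 2 * θ)) / -(3 / 5 * R))
     = 5 / 3 / R * Real.exp (-(2 / 7 * R)) := by
    rw [neg_div_neg_eq, ← mul_div_assoc, ← Real.exp_add]
    rw [show R * (-(2 / 7) + 3 / 5 * (2 + 2 * θ)) + -(3 / 5 * R) * (2 + 2 * θ) = -(2 / 7 * R) by ring]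
    field_simp
  rw [h8] at hle
  have h9 := ec_x_exp (2 / 7 * R) (by positivity)
  rw [ecB_eq R θ n hn, hsplit, mul_add, add_sub_cancel_left]
  calc R * ∫ τ in Ioi (2 + 2 * θ), Real.exp (R * ecF θ τ)
      ≤ R * (5 / 3 / R * Real.exp (-(2 / 7 * R))) := by gcongr
    _ = 5 / 3 * Real.exp (-(2 / 7 * R)) := by field_simp
    _ ≤ 5 / 3 * (1 / (2 / 7 * R)) := by gcongr
    _ = (35 / 6) / R := by field_simp; norm_num
    _ ≤ 6 / R := by gcongr; norm_num

noncomputable def ecK (R θ : ℝ) : ℝ := R * ∫ τ in (0:ℝ)..(2 + 2 * θ), Real.exp (R * ecG θ τ)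

lemma ecK_lower (R θ : ℝ) (hR : 0 < R) (hθ : 0 ≤ θ) (h1 : θ ≤ 1) (n : ℕ) (hn : (n:ℝ) = R * (1 + θ)) :
    ecB R n - R * θ ^ 4 / 4 * ecB R n - 6 / R ≤ ecK R θ := by
  have hL : (0:ℝ) ≤ 2 + 2 * θ := by positivity
  have ht := ecB_tail R θ hR hθ h1 n hn
  have hB := ecB_ge R θ 0 (2 + 2 * θ) hR n hn le_rfl hL
  have hm := intervalIntegral.integral_mono_on (μ := volume)
    (f := fun τ => Real.exp (- (R * θ ^ 4 / 4)) * Real.exp (R * ecF θ τ))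
    (g := fun τ => Real.exp (R * ecG θ τ)) hL ((ecF_ii R θ _ _ le_rfl hL).const_mul _)
    (ecG_ii R θ _ _ le_rfl hL) (fun x hx => by
      rw [← Real.exp_add]
      apply Real.exp_le_exp.2
      have := ecD_lower θ x hθ hx.1
      nlinarith)
  rw [intervalIntegral.integral_const_mul] at hm
  set I := ∫ τ in (0:ℝ)..(2 + 2 * θ), Real.exp (R * ecF θ τ) with hI
  have hI0 : 0 ≤ I := intervalIntegral.integral_nonneg hL (fun x _ => (Real.exp_pos _).le)
  have he := Real.add_one_le_exp (- (R * θ ^ 4 / 4))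
  have h3 : R * (Real.exp (- (R * θ ^ 4 / 4)) * I) ≤ ecK R θ := by unfold ecK; gcongr
  have h4 : R * I * (1 - R * θ ^ 4 / 4) ≤ R * (Real.exp (- (R * θ ^ 4 / 4)) * I) := by
    have : 0 ≤ R * I := by positivity
    nlinarith
  have h5 : R * θ ^ 4 / 4 * (R * I) ≤ R * θ ^ 4 / 4 * ecB R n := by gcongr
  nlinarith

lemma ec_pointwise (R θ τ : ℝ) (hR : 0 < R) (hθ : 0 ≤ θ) (hτ : 0 ≤ τ) (h4 : τ ≤ 4) :
    Real.exp (R * ecG θ τ) - Real.exp (R * ecF θ τ) ≤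
      Real.exp (R * ecF θ θ) * (648 * (1 / R + θ ^ 2)) * Real.exp (-(R / 36) * (τ - θ) ^ 2) := by
  rcases le_total τ θ with h | h
  · have h1 := ecD_nonpos θ τ hτ h
    have h2 : Real.exp (R * ecG θ τ) ≤ Real.exp (R * ecF θ τ) := by
      apply Real.exp_le_exp.2; gcongr
    have h3 : 0 ≤ Real.exp (R * ecF θ θ) * (648 * (1 / R + θ ^ 2)) * Real.exp (-(R / 36) * (τ - θ) ^ 2) := by
      positivity
    linarith
  · have hd := ecD_upper θ τ hθ h
    have hg := ecG_gauss θ τ hθ h h4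
    have h0 := ecD_nonpos θ θ hθ le_rfl
    set y := τ - θ with hy
    have hy0 : 0 ≤ y := by linarith
    set q := R / 36 * y ^ 2 with hq
    have hq0 : 0 ≤ q := by positivity
    have e1 : Real.exp (R * ecF θ τ) = Real.exp (R * ecG θ τ) * Real.exp (-(R * (ecG θ τ - ecF θ τ))) := by
      rw [← Real.exp_add]; congr 1; ring
    have e2 := Real.add_one_le_exp (-(R * (ecG θ τ - ecF θ τ)))
    have e3 : R * (ecG θ τ - ecF θ τ) ≤ R * (y ^ 2 * τ ^ 2 / 8) := by gcongr
    have e4 : R * (y ^ 2 * τ ^ 2 / 8) ≤ 648 * (1 / R + θ ^ 2) * Real.exp q := by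
      have t1 : τ ^ 2 ≤ 2 * y ^ 2 + 2 * θ ^ 2 := by
        have : τ = y + θ := by rw [hy]; ring
        rw [this]; nlinarith [sq_nonneg (y - θ)]
      have t2 : R * (y ^ 2 * τ ^ 2 / 8) ≤ R * (y ^ 2 * (2 * y ^ 2 + 2 * θ ^ 2) / 8) := by gcongr
      have t3 : R * (y ^ 2 * (2 * y ^ 2 + 2 * θ ^ 2) / 8) = 324 * (1 / R) * q ^ 2 + 9 * θ ^ 2 * q := by
        rw [hq]; field_simp; ring
      have t4 : q ^ 2 ≤ 2 * Real.exp q := by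
        have := Real.quadratic_le_exp_of_nonneg hq0
        linarith
      have t5 : q ≤ Real.exp q := by linarith [Real.add_one_le_exp q]
      have t6 : 324 * (1 / R) * q ^ 2 ≤ 324 * (1 / R) * (2 * Real.exp q) := by gcongr
      have t7 : 9 * θ ^ 2 * q ≤ 9 * θ ^ 2 * Real.exp q := by gcongr
      have t8 : 0 ≤ θ ^ 2 * Real.exp q := by positivity
      nlinarith
    have e5 : Real.exp (R * ecG θ τ) ≤ Real.exp (R * ecF θ θ) * (Real.exp (-q) * Real.exp (-q)) := by
      rw [← Real.exp_add, ← Real.exp_add]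
      apply Real.exp_le_exp.2
      have : R * ecG θ τ ≤ R * (ecF θ θ - y ^ 2 / 18) := by
        apply mul_le_mul_of_nonneg_left _ hR.le; linarith
      rw [hq]; linarith
    have e6 : -(R / 36) * y ^ 2 = - q := by rw [hq]; ring
    rw [e6]
    have e7 : Real.exp q * Real.exp (-q) = 1 := by rw [← Real.exp_add]; simp
    calc Real.exp (R * ecG θ τ) - Real.exp (R * ecF θ τ)
        ≤ Real.exp (R * ecG θ τ) * (648 * (1 / R + θ ^ 2) * Real.exp q) := by
          have := Real.exp_pos (R * ecG θ τ)
          rw [e1]; nlinarith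
      _ ≤ Real.exp (R * ecF θ θ) * (Real.exp (-q) * Real.exp (-q)) * (648 * (1 / R + θ ^ 2) * Real.exp q) := by
          gcongr
      _ = Real.exp (R * ecF θ θ) * (648 * (1 / R + θ ^ 2)) * Real.exp (-q) * (Real.exp q * Real.exp (-q)) := by ring
      _ = _ := by rw [e7, mul_one]

lemma ecK_upper (R θ : ℝ) (hR : 0 < R) (hθ : 0 ≤ θ) (h1 : θ ≤ 1) (n : ℕ) (hn : (n:ℝ) = R * (1 + θ)) :
    ecK R θ ≤ ecB R n + 16000 * (1 / R + θ ^ 2) * ecB R n := by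
  have hL : (0:ℝ) ≤ 2 + 2 * θ := by positivity
  have hB := ecB_ge R θ 0 (2 + 2 * θ) hR n hn le_rfl hL
  set M := Real.exp (R * ecF θ θ) * (648 * (1 / R + θ ^ 2)) with hM
  have hM0 : 0 ≤ M := by positivity
  have hgint : Integrable (fun τ : ℝ => Real.exp (-(R / 36) * (τ - θ) ^ 2)) :=
    (integrable_exp_neg_mul_sq (b := R / 36) (by positivity)).comp_sub_right θ
  have hm := intervalIntegral.integral_mono_on (μ := volume)
    (f := fun τ => Real.exp (R * ecG θ τ) - Real.exp (R * ecF θ τ))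
    (g := fun τ => M * Real.exp (-(R / 36) * (τ - θ) ^ 2)) hL
    ((ecG_ii R θ _ _ le_rfl hL).sub (ecF_ii R θ _ _ le_rfl hL))
    (hgint.intervalIntegrable.const_mul _)
    (fun x hx => ec_pointwise R θ x hR hθ hx.1 (by linarith [hx.2]))
  rw [intervalIntegral.integral_sub (ecG_ii R θ _ _ le_rfl hL) (ecF_ii R θ _ _ le_rfl hL),
    intervalIntegral.integral_const_mul] at hm
  have hs : 0 < Real.sqrt R := Real.sqrt_pos.2 hR
  have hgauss : ∫ τ in (0:ℝ)..(2 + 2 * θ), Real.exp (-(R / 36) * (τ - θ) ^ 2) ≤ 12 / Real.sqrt R := by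
    rw [intervalIntegral.integral_of_le hL]
    refine (setIntegral_le_integral hgint (Filter.Eventually.of_forall fun x => (Real.exp_pos _).le)).trans ?_
    rw [integral_sub_right_eq_self (fun τ : ℝ => Real.exp (-(R / 36) * τ ^ 2)) θ, integral_gaussian]
    rw [le_div_iff₀ hs, ← Real.sqrt_mul (by positivity)]
    rw [show Real.pi / (R / 36) * R = 36 * Real.pi by field_simp]
    apply Real.sqrt_le_iff.2
    have := Real.pi_lt_four
    constructor <;> linarith
  have hpk := ecB_peak R θ hR hθ n hn
  have hhalf : Real.exp (1 / 2) ≤ 2 := by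
    have := Real.exp_one_lt_d9
    have h2 : Real.exp (1 / 2) * Real.exp (1 / 2) = Real.exp 1 := by rw [← Real.exp_add]; norm_num
    have := Real.exp_pos (1 / 2)
    nlinarith
  have hpk2 : Real.sqrt R * Real.exp (R * ecF θ θ) ≤ 2 * ecB R n := by
    have h3 : Real.exp (-(1 / 2)) * Real.exp (1 / 2) = 1 := by rw [← Real.exp_add]; simp
    have hBpos := ecB_ge_one R hR n
    calc Real.sqrt R * Real.exp (R * ecF θ θ)
        = Real.sqrt R * Real.exp (R * ecF θ θ) * Real.exp (-(1 / 2)) * Real.exp (1 / 2) := by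
          rw [mul_assoc _ (Real.exp (-(1 / 2))), h3, mul_one]
      _ ≤ ecB R n * 2 := by gcongr
      _ = _ := by ring
  have hfin : R * (M * (12 / Real.sqrt R)) ≤ 16000 * (1 / R + θ ^ 2) * ecB R n := by
    have : R * (M * (12 / Real.sqrt R)) = 7776 * (1 / R + θ ^ 2) * (Real.sqrt R * Real.exp (R * ecF θ θ)) := by
      rw [hM]
      nth_rewrite 1 [← Real.mul_self_sqrt hR.le]
      field_simp
      ring
    rw [this]
    have hBpos := ecB_ge_one R hR n
    calc 7776 * (1 / R + θ ^ 2) * (Real.sqrt R * Real.exp (R * ecF θ θ))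
        ≤ 7776 * (1 / R + θ ^ 2) * (2 * ecB R n) := by gcongr
      _ = 15552 * ((1 / R + θ ^ 2) * ecB R n) := by ring
      _ ≤ 16000 * ((1 / R + θ ^ 2) * ecB R n) := by gcongr; norm_num
      _ = _ := by ring
  have h5 : R * ((∫ τ in (0:ℝ)..(2 + 2 * θ), Real.exp (R * ecG θ τ)) -
      ∫ τ in (0:ℝ)..(2 + 2 * θ), Real.exp (R * ecF θ τ)) ≤ R * (M * (12 / Real.sqrt R)) := by
    apply mul_le_mul_of_nonneg_left _ hR.le
    exact hm.trans (by gcongr)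
  unfold ecK
  linarith

lemma ecJ_formula (R θ : ℝ) (hR : 0 < R) (hθ : 0 ≤ θ) :
    ∫ τ in (0:ℝ)..(2 + 2 * θ), R * ((2 + θ) / (2 + τ)) * Real.exp (R * ecG θ τ)
      = (1 - 1 / (4 * R)) * ecK R θ - 1 / 2 + (2 + θ) / 2 * Real.exp (R * ecG θ (2 + 2 * θ)) := by
  have hL : (0:ℝ) ≤ 2 + 2 * θ := by positivity
  have hc : ContinuousOn (fun τ => R * ((2 + θ) / (2 + τ)) * Real.exp (R * ecG θ τ)) (uIcc 0 (2 + 2 * θ)) := by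
    rw [uIcc_of_le hL]
    apply ContinuousOn.mul
    · apply ContinuousOn.mul continuousOn_const
      apply ContinuousOn.div continuousOn_const (by fun_prop)
      intro x hx
      have := hx.1
      positivity
    · exact (ecG_cont R θ).mono (fun x hx => hx.1)
  have hii := hc.intervalIntegrable (μ := volume)
  have hG := ecG_ii R θ _ _ le_rfl hL
  have key := intervalIntegral.integral_eq_sub_of_hasDerivAt (a := 0) (b := 2 + 2 * θ)
    (f := fun τ => (2 + τ) / 4 * Real.exp (R * ecG θ τ))
    (f' := fun τ => R * ((2 + θ) / (2 + τ)) * Real.exp (R * ecG θ τ)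
      - (R - 1 / 4) * Real.exp (R * ecG θ τ)) (fun x hx => by
      rw [uIcc_of_le hL] at hx
      have h0 := hx.1
      have := (((hasDerivAt_id x).const_add 2).div_const 4).mul (((ecG_deriv θ x h0).const_mul R).exp)
      refine this.congr_deriv ?_
      simp only [id]
      field_simp
      ring) (hii.sub (hG.const_mul _))
  rw [intervalIntegral.integral_sub hii (hG.const_mul _), intervalIntegral.integral_const_mul, ecG_zero] at key
  unfold ecK
  simp only [mul_zero, Real.exp_zero] at key
  have e : (R - 1 / 4) * (∫ τ in (0:ℝ)..(2 + 2 * θ), Real.exp (R * ecG θ τ))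
     = (1 - 1 / (4 * R)) * (R * ∫ τ in (0:ℝ)..(2 + 2 * θ), Real.exp (R * ecG θ τ)) := by
    field_simp
  rw [← e]
  linarith

lemma ecJ_subst (δ θ : ℝ) (hδ : 0 < δ) (hθ : 0 ≤ θ) :
    ∫ x in (-(1 / δ))..(θ / δ), (2 + θ) / (2 + δ * x) *
        Real.exp (2 / δ * (θ / δ - x) + 4 / δ ^ 2 * (Real.log (2 + δ * x) - Real.log (2 + θ)))
      = δ * ∫ τ in (0:ℝ)..(2 + 2 * θ), (1 / δ ^ 2) * ((2 + θ) / (2 + τ)) * Real.exp ((1 / δ ^ 2) * ecG θ τ) := by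
  have hL : (0:ℝ) ≤ 2 + 2 * θ := by positivity
  set X : ℝ → ℝ := fun τ => θ / δ - (2 + θ) / δ * (τ / (2 + τ)) with hX
  set X' : ℝ → ℝ := fun τ => - ((2 + θ) / δ * (2 / (2 + τ) ^ 2)) with hX'
  have hXd : ∀ τ, 0 ≤ τ → HasDerivAt X (X' τ) τ := by
    intro τ h
    have h1 : (2 + τ) ≠ 0 := by positivity
    have := (((hasDerivAt_id τ).div ((hasDerivAt_id τ).const_add 2) h1).const_mul ((2 + θ) / δ)).const_sub (θ / δ)
    refine this.congr_deriv ?_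
    simp only [id, hX']
    field_simp
    ring
  have h2X : ∀ τ, 0 ≤ τ → 2 + δ * X τ = 2 * (2 + θ) / (2 + τ) := by
    intro τ h
    simp only [hX]
    field_simp
    ring
  have hX0 : X 0 = θ / δ := by simp [hX]
  have hXL : X (2 + 2 * θ) = -(1 / δ) := by
    simp only [hX]
    field_simp
    ring
  have hs := intervalIntegral.integral_comp_mul_deriv'' (a := 0) (b := 2 + 2 * θ) (f := X) (f' := X')
    (g := fun x => (2 + θ) / (2 + δ * x) *
        Real.exp (2 / δ * (θ / δ - x) + 4 / δ ^ 2 * (Real.log (2 + δ * x) - Real.log (2 + θ))))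
    (by
      rw [uIcc_of_le hL]
      exact fun x hx => (hXd x hx.1).continuousAt.continuousWithinAt)
    (by
      rw [min_eq_left hL, max_eq_right hL]
      exact fun x hx => (hXd x hx.1.le).hasDerivWithinAt)
    (by
      rw [uIcc_of_le hL]
      apply ContinuousOn.neg
      apply ContinuousOn.mul continuousOn_const
      apply ContinuousOn.div continuousOn_const (by fun_prop)
      intro x hx
      have := hx.1
      positivity)
    (by
      rw [uIcc_of_le hL]
      have hne : ∀ x ∈ X '' Icc 0 (2 + 2 * θ), 2 + δ * x ≠ 0 := by
        rintro x ⟨τ, hτ, rfl⟩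
        rw [h2X τ hτ.1]
        have := hτ.1
        positivity
      apply ContinuousOn.mul
      · exact ContinuousOn.div continuousOn_const (by fun_prop) hne
      · apply ContinuousOn.rexp
        apply ContinuousOn.add (by fun_prop)
        apply ContinuousOn.mul continuousOn_const
        exact (ContinuousOn.log (by fun_prop) hne).sub continuousOn_const)
  rw [hX0, hXL] at hs
  rw [intervalIntegral.integral_symm, ← hs, ← intervalIntegral.integral_const_mul, ← intervalIntegral.integral_neg]
  apply intervalIntegral.integral_congr
  intro τ hτ
  rw [uIcc_of_le hL] at hτ
  have h0 := hτ.1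
  have e1 : 2 / δ * (θ / δ - X τ) + 4 / δ ^ 2 * (Real.log (2 + δ * X τ) - Real.log (2 + θ))
      = (1 / δ ^ 2) * ecG θ τ := by
    rw [h2X τ h0, Real.log_div (by positivity) (by positivity), Real.log_mul (by positivity) (by positivity)]
    simp only [hX, ecG]
    field_simp
    ring
  simp only [Function.comp]
  rw [e1, h2X τ h0]
  simp only [hX']
  field_simp

lemma ec_discrete (R θ : ℝ) (n : ℕ) (hR : 0 < R) (hθ : 0 < θ) (hn : (n:ℝ) = R * (1 + θ))
    (p : ℕ → ℝ) (hs : (∑' j : ℕ, p j) = 1)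
    (hb : ∀ j : ℕ, R * p j = min ((j : ℝ) + 1) (n : ℝ) * p (j + 1)) :
    p n * (ecB R n + 1 / θ) = 1 ∧
    ∀ k : ℕ, n ≤ k → ∑' j : ℕ, (if k ≤ j then p j else 0) = p n * (1 / (1 + θ)) ^ (k - n) * ((1 + θ) / θ) := by
  have hsum : Summable p := by
    by_contra h
    rw [tsum_eq_zero_of_not_summable h] at hs
    norm_num at hs
  have hnpos : (0:ℝ) < n := by rw [hn]; positivity
  have h1 : ∀ j : ℕ, j ≤ n → ∑ i ∈ Finset.range (j + 1), p i = p j * ecB R j := by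
    intro j
    induction j with
    | zero => intro _; simp [ecB_zero R hR]
    | succ j ih =>
      intro hj
      rw [Finset.sum_range_succ, ih (by omega), ecB_succ R hR]
      have h2 := hb j
      have h3 : (j:ℝ) + 1 ≤ n := by exact_mod_cast hj
      rw [min_eq_left h3] at h2
      have h4 : p j = ((j:ℝ) + 1) / R * p (j + 1) := by field_simp; linarith
      rw [h4]; ring
  have h2 : ∀ i : ℕ, p (n + i) = p n * (1 / (1 + θ)) ^ i := by
    intro i
    induction i with
    | zero => simp
    | succ i ih =>
      have h2 := hb (n + i)
      have h3 : (n:ℝ) ≤ ((n + i : ℕ):ℝ) + 1 := by push_cast; linarith [(Nat.cast_nonneg i : (0:ℝ) ≤ i)]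
      rw [min_eq_right h3, hn, ih] at h2
      rw [← add_assoc, pow_succ]
      field_simp at h2 ⊢
      linarith
  have hr0 : 0 ≤ 1 / (1 + θ) := by positivity
  have hr1 : 1 / (1 + θ) < 1 := by rw [div_lt_one (by positivity)]; linarith
  have hinv : (1 - 1 / (1 + θ))⁻¹ = (1 + θ) / θ := by
    have : 1 - 1 / (1 + θ) = θ / (1 + θ) := by field_simp; ring
    rw [this, inv_div]
  have htail : ∀ k : ℕ, n ≤ k → ∑' i : ℕ, p (i + k) = p n * (1 / (1 + θ)) ^ (k - n) * ((1 + θ) / θ) := by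
    intro k hk
    have : ∀ i : ℕ, p (i + k) = p n * (1 / (1 + θ)) ^ (k - n) * (1 / (1 + θ)) ^ i := by
      intro i
      rw [show i + k = n + ((k - n) + i) by omega, h2, pow_add]; ring
    simp_rw [this]
    rw [tsum_mul_left, tsum_geometric_of_lt_one hr0 hr1, hinv]
  constructor
  · have h3 := hsum.sum_add_tsum_nat_add n
    rw [hs, htail n le_rfl] at h3
    have h4 := h1 n le_rfl
    rw [Finset.sum_range_succ] at h4
    have : (1 + θ) / θ = 1 / θ + 1 := by field_simp
    simp only [Nat.sub_self, pow_zero, mul_one] at h3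
    rw [this] at h3
    linarith
  · intro k hk
    have hsf : Summable (fun j : ℕ => if k ≤ j then p j else 0) := by
      refine (hsum.indicator {j | k ≤ j}).congr fun j => ?_
      simp [Set.indicator]
    rw [← hsf.sum_add_tsum_nat_add k, ← htail k hk]
    have : ∑ i ∈ Finset.range k, (if k ≤ i then p i else 0) = 0 := by
      apply Finset.sum_eq_zero
      intro i hi
      rw [Finset.mem_range] at hi
      rw [if_neg (by omega)]
    rw [this, zero_add]
    simp

lemma ec_continuous (mu δ c θ kappa : ℝ) (hmu : 0 < mu) (hδ : 0 < δ) (hc : 0 < c) (hθ : θ = δ * c)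
    (a b nu : ℝ → ℝ)
    (hb : ∀ x, b x = if x ≤ c then -(mu * x) else -(mu * c))
    (ha : ∀ x, a x = if x ≤ -(1 / δ) then mu else if x ≤ c then mu * (2 + δ * x) else mu * (2 + δ * c))
    (hk : 0 < kappa)
    (hnu : ∀ x, nu x = (kappa / a x) * Real.exp (∫ y in (0:ℝ)..x, 2 * b y / a y))
    (hfint : (∫ x, nu x) = 1) :
    0 < nu c ∧
    (∀ z, c ≤ z → ∫ x in Ici z, nu x = nu c * Real.exp (-(2 * c / (2 + θ)) * (z - c)) * ((2 + θ) / (2 * c))) ∧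
    ∃ J : ℝ, nu c * (δ * J + (2 + θ) / (2 * c)) = 1 ∧
      (1 - 1 / (4 * (1 / δ ^ 2))) * ecK (1 / δ ^ 2) θ - 1 / 2
        + (2 + θ) / 2 * Real.exp ((1 / δ ^ 2) * ecG θ (2 + 2 * θ)) ≤ J ∧
      J ≤ (1 - 1 / (4 * (1 / δ ^ 2))) * ecK (1 / δ ^ 2) θ - 1 / 2
        + (2 + θ) * Real.exp ((1 / δ ^ 2) * ecG θ (2 + 2 * θ)) ∧ 0 ≤ J := by
  have hθ0 : 0 < θ := by rw [hθ]; positivity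
  have hcθ : c = θ / δ := by rw [hθ]; field_simp
  have hδi : 0 < 1 / δ := by positivity
  have hmc : -(1 / δ) < c := by linarith
  have hb' : b = fun x => -(mu * min x c) := by
    funext x
    rw [hb]
    split_ifs with h
    · rw [min_eq_left h]
    · rw [min_eq_right (by linarith)]
  have ha' : a = fun x => mu * (2 + δ * max (-(1 / δ)) (min x c)) := by
    funext x
    rw [ha]
    split_ifs with h1 h2
    · rw [max_eq_left ((min_le_left _ _).trans h1)]
      field_simp; ring
    · rw [min_eq_left h2, max_eq_right (by linarith)]
    · rw [min_eq_right (by linarith), max_eq_right (by linarith)]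
  have hapos : ∀ x, 0 < a x := by
    intro x
    rw [ha']
    have h1 : -(1 / δ) ≤ max (-(1 / δ)) (min x c) := le_max_left _ _
    have h2 : δ * (-(1 / δ)) ≤ δ * max (-(1 / δ)) (min x c) := by gcongr
    have h3 : δ * (-(1 / δ)) = -1 := by field_simp
    have : 0 < 2 + δ * max (-(1 / δ)) (min x c) := by linarith
    positivity
  have hacont : Continuous a := by rw [ha']; fun_prop
  have hbcont : Continuous b := by rw [hb']; fun_prop
  have hrcont : Continuous (fun y => 2 * b y / a y) :=
    (continuous_const.mul hbcont).div hacont (fun x => (hapos x).ne')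
  have hri : ∀ s t, IntervalIntegrable (fun y => 2 * b y / a y) volume s t :=
    fun s t => hrcont.intervalIntegrable s t
  have hnupos : ∀ x, 0 < nu x := fun x => by
    rw [hnu]; have := hapos x; positivity
  have hrel : ∀ x y, nu x = nu y * (a y / a x) * Real.exp (∫ t in y..x, 2 * b t / a t) := by
    intro x y
    rw [hnu x, hnu y, ← intervalIntegral.integral_add_adjacent_intervals (hri 0 y) (hri y x), Real.exp_add]
    have := hapos x
    have := hapos y
    field_simp
  have hac : a c = mu * (2 + θ) := by
    rw [ha, if_neg (by linarith), if_pos le_rfl, hθ]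
  have ham : a (-(1 / δ)) = mu := by rw [ha, if_pos le_rfl]
  have hi : Integrable nu := by
    by_contra h
    rw [integral_undef h] at hfint
    norm_num at hfint
  -- region x ≥ c
  have hr1 : ∀ x, c ≤ x → nu x = nu c * Real.exp (-(2 * c / (2 + θ)) * (x - c)) := by
    intro x hx
    have hax : a x = mu * (2 + θ) := by
      rw [ha']; simp only
      rw [min_eq_right hx, max_eq_right hmc.le, hθ]
    rw [hrel x c, hac, hax, div_self (by positivity), mul_one]
    congr 2
    have : ∫ t in c..x, 2 * b t / a t = ∫ t in c..x, -(2 * c / (2 + θ)) := by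
      apply intervalIntegral.integral_congr
      intro t ht
      rw [uIcc_of_le hx] at ht
      simp only [ha', hb']
      rw [min_eq_right ht.1, max_eq_right hmc.le, ← hθ]
      field_simp
    rw [this, intervalIntegral.integral_const, smul_eq_mul, mul_comm]
  -- middle
  have hr2 : ∀ x, -(1 / δ) ≤ x → x ≤ c → nu x = nu c * ((2 + θ) / (2 + δ * x) *
        Real.exp (2 / δ * (θ / δ - x) + 4 / δ ^ 2 * (Real.log (2 + δ * x) - Real.log (2 + θ)))) := by
    intro x hx1 hx2
    have hpos : ∀ t, -(1 / δ) ≤ t → 0 < 2 + δ * t := by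
      intro t ht
      have h2 : δ * (-(1 / δ)) ≤ δ * t := by gcongr
      have h3 : δ * (-(1 / δ)) = -1 := by field_simp
      linarith
    have hax : a x = mu * (2 + δ * x) := by
      rw [ha']; simp only
      rw [min_eq_left hx2, max_eq_right hx1]
    have hpx := hpos x hx1
    have hfint2 : ∫ t in x..c, 2 * b t / a t =
        (-(2 / δ) * c + 4 / δ ^ 2 * Real.log (2 + δ * c)) - (-(2 / δ) * x + 4 / δ ^ 2 * Real.log (2 + δ * x)) := by
      apply intervalIntegral.integral_eq_sub_of_hasDerivAt (f := fun t => -(2 / δ) * t + 4 / δ ^ 2 * Real.log (2 + δ * t)) _ (hri _ _)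
      intro t ht
      rw [uIcc_of_le hx2] at ht
      have hpt := hpos t (hx1.trans ht.1)
      have := ((hasDerivAt_id t).const_mul (-(2 / δ))).add
        (((((hasDerivAt_id t).const_mul δ).const_add 2).log hpt.ne').const_mul (4 / δ ^ 2))
      refine this.congr_deriv ?_
      simp only [ha', hb', id]
      rw [min_eq_left ht.2, max_eq_right (hx1.trans ht.1)]
      field_simp
      ring
    rw [hrel x c, hac, hax, mul_div_mul_left _ _ hmu.ne', mul_assoc, intervalIntegral.integral_symm, hfint2]
    congr 3
    rw [← hθ, hcθ]
    ring
  -- left region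
  have hr3 : ∀ x, x ≤ -(1 / δ) → nu x = nu (-(1 / δ)) * Real.exp (1 / δ ^ 2 - x ^ 2) := by
    intro x hx
    have hax : a x = mu := by rw [ha, if_pos hx]
    rw [hrel x (-(1 / δ)), ham, hax, div_self hmu.ne', mul_one]
    congr 2
    rw [intervalIntegral.integral_symm]
    have : ∫ t in x..(-(1 / δ)), 2 * b t / a t = -(-(1 / δ)) ^ 2 - - x ^ 2 := by
      apply intervalIntegral.integral_eq_sub_of_hasDerivAt (f := fun t => - t ^ 2) _ (hri _ _)
      intro t ht
      rw [uIcc_of_le hx] at ht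
      refine ((hasDerivAt_id t).pow 2).neg.congr_deriv ?_
      rw [ha, if_pos ht.2, hb, if_pos (by linarith [ht.2])]
      simp [id]
      field_simp
    rw [this]
    field_simp
    ring
  have htail : ∀ z, c ≤ z → ∫ x in Ici z, nu x = nu c * Real.exp (-(2 * c / (2 + θ)) * (z - c)) * ((2 + θ) / (2 * c)) := by
    intro z hz
    rw [integral_Ici_eq_integral_Ioi]
    have hβ : -(2 * c / (2 + θ)) < 0 := by rw [neg_lt_zero]; positivity
    have : ∫ x in Ioi z, nu x = ∫ x in Ioi z, nu c * Real.exp (2 * c / (2 + θ) * c) * Real.exp (-(2 * c / (2 + θ)) * x) := by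
      apply setIntegral_congr_fun measurableSet_Ioi
      intro x hx
      simp only
      rw [hr1 x (hz.trans (le_of_lt hx)), mul_assoc, ← Real.exp_add]
      congr 2; ring
    rw [this, integral_const_mul, integral_exp_mul_Ioi hβ, neg_div_neg_eq, div_div_eq_mul_div, ]
    rw [show -(2 * c / (2 + θ)) * (z - c) = 2 * c / (2 + θ) * c + -(2 * c / (2 + θ)) * z by ring, Real.exp_add]
    ring
  refine ⟨hnupos c, htail, ?_⟩
  have hsplit1 : ∫ x, nu x = (∫ x in Iic c, nu x) + ∫ x in Ioi c, nu x :=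
    (intervalIntegral.integral_Iic_add_Ioi hi.integrableOn hi.integrableOn).symm
  have hsplit2 : ∫ x in Iic c, nu x = (∫ x in Iic (-(1 / δ)), nu x) + ∫ x in (-(1 / δ))..c, nu x := by
    rw [← intervalIntegral.integral_Iic_sub_Iic (hi.integrableOn) (hi.integrableOn)]; ring
  have hmid : ∫ x in (-(1 / δ))..c, nu x = nu c * (δ * ((1 - 1 / (4 * (1 / δ ^ 2))) * ecK (1 / δ ^ 2) θ - 1 / 2
        + (2 + θ) / 2 * Real.exp ((1 / δ ^ 2) * ecG θ (2 + 2 * θ)))) := by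
    rw [← ecJ_formula (1 / δ ^ 2) θ (by positivity) hθ0.le, ← ecJ_subst δ θ hδ hθ0.le,
      ← intervalIntegral.integral_const_mul, ← hcθ]
    apply intervalIntegral.integral_congr
    intro x hx
    rw [uIcc_of_le hmc.le] at hx
    simp only
    rw [hr2 x hx.1 hx.2, hcθ]
  have hT0 : 0 ≤ ∫ x in Iic (-(1 / δ)), nu x := integral_nonneg fun x => (hnupos x).le
  have hM0 : 0 ≤ ∫ x in (-(1 / δ))..c, nu x := intervalIntegral.integral_nonneg hmc.le fun x _ => (hnupos x).le
  have hnum : nu (-(1 / δ)) = nu c * ((2 + θ) * Real.exp ((1 / δ ^ 2) * ecG θ (2 + 2 * θ))) := by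
    rw [hr2 (-(1 / δ)) le_rfl hmc.le]
    have e1 : 2 + δ * (-(1 / δ)) = 1 := by field_simp; ring
    rw [e1, Real.log_one, div_one]
    congr 3
    unfold ecG
    rw [show 2 + (2 + 2 * θ) = 2 * (2 + θ) by ring, Real.log_mul (by norm_num) (by positivity)]
    field_simp
    ring
  have hT1 : ∫ x in Iic (-(1 / δ)), nu x ≤ nu (-(1 / δ)) * (δ / 2) := by
    have hexpi : IntegrableOn (fun x => Real.exp (2 / δ * x)) (Iic (-(1 / δ))) :=
      integrableOn_exp_mul_Iic (by positivity) _
    have : ∫ x in Iic (-(1 / δ)), nu x ≤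
        ∫ x in Iic (-(1 / δ)), nu (-(1 / δ)) * Real.exp (2 / δ ^ 2) * Real.exp (2 / δ * x) := by
      apply setIntegral_mono_on hi.integrableOn (hexpi.const_mul _) measurableSet_Iic
      intro x hx
      rw [hr3 x hx, mul_assoc, ← Real.exp_add]
      apply mul_le_mul_of_nonneg_left _ (hnupos _).le
      apply Real.exp_le_exp.2
      have := sq_nonneg (x + 1 / δ)
      have e : (x + 1 / δ) ^ 2 = x ^ 2 + 2 / δ * x + 1 / δ ^ 2 := by field_simp; ring
      have e2 : 2 / δ ^ 2 = 2 * (1 / δ ^ 2) := by ring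
      linarith
    refine this.trans (le_of_eq ?_)
    rw [integral_const_mul, integral_exp_mul_Iic (by positivity), mul_assoc, ← mul_div_assoc, ← Real.exp_add]
    rw [show 2 / δ ^ 2 + 2 / δ * -(1 / δ) = 0 by field_simp; ring, Real.exp_zero]
    field_simp
  have hcpos := hnupos c
  refine ⟨(∫ x in Iic c, nu x) / (nu c * δ), ?_, ?_, ?_, ?_⟩
  · have h3 := htail c le_rfl
    rw [integral_Ici_eq_integral_Ioi, sub_self, mul_zero, Real.exp_zero, mul_one] at h3
    rw [hsplit1, h3] at hfint
    rw [← hfint]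
    field_simp
  · rw [le_div_iff₀ (by positivity), hsplit2]
    rw [hmid] at *
    linarith
  · rw [div_le_iff₀ (by positivity), hsplit2, hmid]
    rw [hnum] at hT1
    nlinarith
  · rw [hsplit2]; positivity

lemma ec_log_cubic (θ : ℝ) (h : 0 ≤ θ) : Real.log (1 + θ) - 2 * θ / (2 + θ) ≤ θ ^ 3 := by
  have := ec_mono (u := fun t => t ^ 3 - (Real.log (1 + t) - 2 * t / (2 + t)))
    (u' := fun t => 3 * t ^ 2 - t ^ 2 / ((1 + t) * (2 + t) ^ 2)) h
    (fun x hx => by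
      have h0 := hx.1
      have h1 : (1 + x) ≠ 0 := by positivity
      have h2 : (2 + x) ≠ 0 := by positivity
      have := ((hasDerivAt_id x).pow 3).sub ((((hasDerivAt_id x).const_add 1).log h1).sub
        (((hasDerivAt_id x).const_mul 2).div ((hasDerivAt_id x).const_add 2) h2))
      refine this.congr_deriv ?_
      simp only [id]
      field_simp
      ring) (fun x hx => by
      have h0 := hx.1
      have hd := ec_den x h0
      have : x ^ 2 / ((1 + x) * (2 + x) ^ 2) ≤ x ^ 2 := div_le_self (sq_nonneg x) (by linarith)
      nlinarith [sq_nonneg x])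
  simp at this
  linarith

set_option maxHeartbeats 1000000 in
lemma ec_A (R θ J : ℝ) (hR : 1 / 2 ≤ R) (hθ : 0 < θ) (h1 : θ ≤ 1) (n : ℕ) (hn : (n:ℝ) = R * (1 + θ))
    (hJ1 : (1 - 1 / (4 * R)) * ecK R θ - 1 / 2 + (2 + θ) / 2 * Real.exp (R * ecG θ (2 + 2 * θ)) ≤ J)
    (hJ2 : J ≤ (1 - 1 / (4 * R)) * ecK R θ - 1 / 2 + (2 + θ) * Real.exp (R * ecG θ (2 + 2 * θ)))
    (hJ0 : 0 ≤ J) :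
    |(2 * (1 + θ) / (2 + θ) * J + (1 + θ) / θ) / (ecB R n + 1 / θ) - 1|
      ≤ θ + 33000 * Real.exp (R * θ ^ 2) * (1 / R + θ ^ 2) := by
  have hRp : 0 < R := by linarith
  have hB1 := ecB_ge_one R hRp n
  have hKu := ecK_upper R θ hRp hθ.le h1 n hn
  have hKl := ecK_lower R θ hRp hθ.le h1 n hn
  set B := ecB R n with hB
  set K := ecK R θ with hK
  have hK0 : 0 ≤ K := by
    rw [hK]; unfold ecK
    apply mul_nonneg hRp.le
    exact intervalIntegral.integral_nonneg (by positivity) (fun x _ => (Real.exp_pos _).le)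
  set r := 1 / R with hr
  have hr0 : 0 < r := by positivity
  have hr2 : r ≤ 2 := by rw [hr, div_le_iff₀ hRp]; linarith
  have e4 : 1 / (4 * R) = r / 4 := by rw [hr]; field_simp
  have e6 : 6 / R = 6 * r := by rw [hr]; ring
  rw [e4] at hJ1 hJ2
  rw [e6] at hKl
  have hG : Real.exp (R * ecG θ (2 + 2 * θ)) ≤ 3 * r := by
    have h3 := ecG_end θ hθ.le h1
    have h4 := ec_x_exp (R / 3) (by positivity)
    have h5 : 1 / (R / 3) = 3 * r := by rw [hr]; field_simp
    rw [h5] at h4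
    refine le_trans (Real.exp_le_exp.2 ?_) h4
    nlinarith
  have hGp := Real.exp_pos (R * ecG θ (2 + 2 * θ))
  set X := r + θ ^ 2 with hX
  have hXr : r ≤ X := by rw [hX]; nlinarith
  have hXt : θ ^ 2 ≤ X := by rw [hX]; linarith
  have hX0 : 0 < X := by linarith
  have hX3 : X ≤ 3 := by rw [hX]; nlinarith
  have hXB0 : 0 < X * B := by positivity
  have hJu : J ≤ B - 1 / 2 + 16009 * (X * B) := by
    have t1 : (2 + θ) * Real.exp (R * ecG θ (2 + 2 * θ)) ≤ 3 * (3 * r) := by gcongr; linarith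
    have t2 : r ≤ X * B := by nlinarith
    have t3 : 0 ≤ r * K := by positivity
    linarith
  have hJl : J + 1 - B ≥ - (13000 * Real.exp (R * θ ^ 2) * X) * B := by
    have t1 : r * K ≤ 48001 * (r * B) := by
      have : K ≤ 48001 * B := by nlinarith
      nlinarith
    have t2 : r ≤ r * B := by nlinarith
    have t3 := Real.add_one_le_exp (R * θ ^ 2)
    have t4 : 0 ≤ R * θ ^ 2 := by positivity
    have t5 : R * θ ^ 4 / 4 * B ≤ (R * θ ^ 2) * X * B := by
      have : R * θ ^ 4 / 4 ≤ (R * θ ^ 2) * X := by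
        have : (R * θ ^ 2) * θ ^ 2 ≤ (R * θ ^ 2) * X := by gcongr
        have : 0 ≤ (R * θ ^ 2) * θ ^ 2 := by positivity
        nlinarith
      gcongr
    have t6 : (R * θ ^ 2 + 1) * (X * B) ≤ Real.exp (R * θ ^ 2) * (X * B) := by gcongr
    have t7 : r * B ≤ X * B := by gcongr
    have t8 : 0 ≤ (R * θ ^ 2) * (X * B) := by positivity
    have t9 : 0 < (2 + θ) / 2 * Real.exp (R * ecG θ (2 + 2 * θ)) := by positivity
    have u1 : (1 - r / 4) * K = K - r * K / 4 := by ring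
    have u2 : -(13000 * Real.exp (R * θ ^ 2) * X) * B
        = -(13000 * (Real.exp (R * θ ^ 2) * (X * B))) := by ring
    have u3 : (R * θ ^ 2 + 1) * (X * B) = (R * θ ^ 2) * (X * B) + X * B := by ring
    have u4 : (R * θ ^ 2) * X * B = (R * θ ^ 2) * (X * B) := by ring
    have u5 : (1 - R * θ ^ 4 / 4) * B = B - R * θ ^ 4 / 4 * B := by ring
    rw [u2]
    rw [u1] at hJ1
    rw [u3] at t6
    rw [u4] at t5
    try rw [u5] at hKl
    clear hKu hG hJ2 hX hr hB hK
    linarith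
  have hden : 0 < B + 1 / θ := by positivity
  have hid : (2 * (1 + θ) / (2 + θ) * J + (1 + θ) / θ) / (B + 1 / θ) - 1
      = (J + θ / (2 + θ) * J + 1 - B) / (B + 1 / θ) := by
    rw [div_sub_one hden.ne']
    congr 1
    field_simp
    ring
  have hθJ : θ / (2 + θ) * J ≤ θ / 2 * J := by
    gcongr; linarith
  have hθJ0 : 0 ≤ θ / (2 + θ) * J := by positivity
  have hexp1 : 1 ≤ Real.exp (R * θ ^ 2) := Real.one_le_exp (by positivity)
  set e := Real.exp (R * θ ^ 2) with he
  have heX : X * B ≤ e * X * B := by nlinarith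
  have hrhs : (θ + 33000 * e * X) * (B + 1 / θ) = θ * B + 1 + 33000 * (e * X * B) + 33000 * e * X * (1 / θ) := by
    field_simp
    ring
  have hpos : 0 ≤ 33000 * e * X * (1 / θ) := by positivity
  have hθB : 0 ≤ θ * B := by positivity
  rw [hid, abs_le]
  constructor
  · rw [le_div_iff₀ hden, neg_mul, hrhs]
    nlinarith
  · rw [div_le_iff₀ hden, hrhs]
    have t1 : θ / 2 * J ≤ θ / 2 * (B - 1 / 2 + 16009 * (X * B)) := by gcongr
    have t2 : θ * (X * B) ≤ X * B := by nlinarith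
    nlinarith


set_option maxHeartbeats 1000000 in
/-- Moderate deviations for the Erlang-C model: a universal constant `C > 0`
bounds the relative error between the stationary tail `P(X̃(∞) ≥ z)` and the
tail of the state-dependent diffusion approximation `P(Y_S(∞) ≥ z)`, for
`z = δ(k - R)` with `k > n` and utilization `ρ ≥ 1/2`. -/
theorem erlangC_moderate_deviations :
    ∃ C : ℝ, 0 < C ∧
      ∀ (lam mu : ℝ) (n : ℕ), 0 < lam → 0 < mu → 1 ≤ n →
      ∀ R δ ζ rho : ℝ,
        R = lam / mu → R < (n : ℝ) →
        δ = 1 / Real.sqrt R → ζ = δ * (R - (n : ℝ)) →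
        rho = R / (n : ℝ) → 1 / 2 ≤ rho →
      ∀ pi : ℕ → ℝ,
        (∀ j, 0 ≤ pi j) → (∑' j : ℕ, pi j) = 1 →
        (∀ j : ℕ, lam * pi j = mu * min ((j : ℝ) + 1) (n : ℝ) * pi (j + 1)) →
      ∀ b : ℝ → ℝ,
        (∀ x : ℝ, b x = if x ≤ -ζ then -(mu * x) else mu * ζ) →
      ∀ a : ℝ → ℝ,
        (∀ x : ℝ, a x = if x ≤ -(1 / δ) then mu
                        else if x ≤ -ζ then mu * (2 + δ * x)
                        else mu * (2 + δ * |ζ|)) →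
      ∀ kappa : ℝ, 0 < kappa →
      ∀ nuS : ℝ → ℝ,
        (∀ x : ℝ, nuS x = (kappa / a x) * Real.exp (∫ y in (0:ℝ)..x, 2 * b y / a y)) →
        (∫ x : ℝ, nuS x) = 1 →
      ∀ (k : ℕ) (z : ℝ), n < k → z = δ * ((k : ℝ) - R) →
        |(∑' j : ℕ, if z ≤ δ * ((j : ℝ) - R) then pi j else 0)
            / (∫ x in Set.Ici z, nuS x) - 1|
          ≤ (1 - rho) / rho + 2 * (1 - rho) ^ 2 / rho + δ ^ 2
            + C * Real.exp (ζ ^ 2)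
                * (δ ^ 2 + δ * (1 - rho) / rho + (1 - rho) ^ 2 / rho ^ 2)
            + C * Real.exp (2 * ζ ^ 2) * ζ ^ 2
                * (δ ^ 2 + δ * (1 - rho) / rho + (1 - rho) ^ 2 / rho ^ 2)
                * min (max z 1) ((1 / δ ^ 2) * (1 / |ζ| + δ) ^ 3) := by
  refine ⟨33000, by norm_num, ?_⟩
  intro lam mu n hlam hmu hn1 R δ ζ rho hR hRn hδ hζ hrho hrho2 pi hpi0 hpi1 hbal b hb a ha
    kappa hkappa nu hnu hnu1 k z hk hz
  have hRp : 0 < R := by rw [hR]; positivity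
  have hnp : (0:ℝ) < n := hRp.trans hRn
  have hsq : 0 < Real.sqrt R := Real.sqrt_pos.2 hRp
  have hδp : 0 < δ := by rw [hδ]; positivity
  have hδ2 : 1 / δ ^ 2 = R := by
    rw [hδ, div_pow, Real.sq_sqrt hRp.le]; field_simp
  have hδ2' : δ ^ 2 = 1 / R := by rw [← hδ2]; field_simp
  obtain ⟨c, hc⟩ : ∃ c, c = -ζ := ⟨_, rfl⟩
  have hζc : ζ = -c := by rw [hc]; ring
  have hcp : 0 < c := by
    rw [hc, hζ]
    have : 0 < δ * ((n:ℝ) - R) := mul_pos hδp (by linarith)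
    linarith
  have hcn : c = δ * ((n:ℝ) - R) := by rw [hc, hζ]; ring
  obtain ⟨θ, hθ⟩ : ∃ θ, θ = δ * c := ⟨_, rfl⟩
  have hθp : 0 < θ := by rw [hθ]; positivity
  have hnθ : (n:ℝ) = R * (1 + θ) := by
    have : R * θ = n - R := by
      rw [hθ, hcn]
      rw [show R * (δ * (δ * ((n:ℝ) - R))) = (R * δ ^ 2) * ((n:ℝ) - R) by ring, hδ2']
      field_simp
    linarith
  have hrhoθ : rho = 1 / (1 + θ) := by rw [hrho, hnθ]; field_simp
  have hθ1 : θ ≤ 1 := by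
    rw [hrhoθ, div_le_div_iff₀ (by norm_num) (by positivity)] at hrho2
    linarith
  have hR2 : 1 / 2 ≤ R := by
    have : (1:ℝ) ≤ n := by exact_mod_cast hn1
    nlinarith
  have hq : (1 - rho) / rho = θ := by rw [hrhoθ]; field_simp; ring
  have hq2 : (1 - rho) ^ 2 / rho ^ 2 = θ ^ 2 := by rw [← div_pow, hq]
  have hq3 : δ * (1 - rho) / rho = δ * θ := by rw [mul_div_assoc, hq]
  have hrp : 0 < rho := by linarith
  have hq4 : 0 ≤ 2 * (1 - rho) ^ 2 / rho := by positivity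
  have hζ2 : ζ ^ 2 = c ^ 2 := by rw [hζc]; ring
  have hζa : |ζ| = c := by rw [hζc, abs_neg, abs_of_pos hcp]
  have hRθ : R * θ ^ 2 = c ^ 2 := by
    rw [hθ, ← hδ2]; field_simp
  rw [hq, hq2, hq3, hζ2, hζa]
  obtain ⟨hd1, hd2⟩ := ec_discrete R θ n hRp hθp hnθ pi hpi1 (fun j => by
    have := hbal j
    rw [hR]
    field_simp
    linarith)
  obtain ⟨hv, htail, J, hJ, hJ1, hJ2, hJ0⟩ := ec_continuous mu δ c θ kappa hmu hδp hcp hθ a b nu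
    (fun x => by rw [hb, hζc, neg_neg, mul_neg]) (fun x => by rw [ha, hζa, hζc, neg_neg]) hkappa hnu hnu1
  rw [hδ2] at hJ1 hJ2
  have hA := ec_A R θ J hR2 hθp hθ1 n hnθ hJ1 hJ2 hJ0
  set A := (2 * (1 + θ) / (2 + θ) * J + (1 + θ) / θ) / (ecB R n + 1 / θ) with hAdef
  have hnum : (∑' j : ℕ, if z ≤ δ * ((j : ℝ) - R) then pi j else 0)
      = pi n * (1 / (1 + θ)) ^ (k - n) * ((1 + θ) / θ) := by
    rw [← hd2 k hk.le]
    apply tsum_congr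
    intro j
    have : z ≤ δ * ((j : ℝ) - R) ↔ k ≤ j := by
      rw [hz, mul_le_mul_iff_right₀ hδp, sub_le_sub_iff_right, Nat.cast_le]
    simp only [this]
  set m := k - n with hm
  have hkm : (k:ℝ) = n + m := by rw [hm, Nat.cast_sub hk.le]; ring
  have hzm : z - c = δ * m := by rw [hz, hcn, hkm]; ring
  have hm0 : (0:ℝ) ≤ m := Nat.cast_nonneg m
  have hcz : c ≤ z := by
    have : 0 ≤ δ * m := by positivity
    linarith
  set w := (m:ℝ) * (Real.log (1 + θ) - 2 * θ / (2 + θ)) with hw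
  have hw0 : 0 ≤ w := by
    have h3 := Real.le_log_one_add_of_nonneg hθp.le
    rw [add_comm θ 2] at h3
    apply mul_nonneg hm0; linarith
  have hw1 : w ≤ m * θ ^ 3 := by
    rw [hw]
    have := ec_log_cubic θ hθp.le
    gcongr
  have hpow : (1 / (1 + θ)) ^ m = Real.exp (-w) * Real.exp (-(2 * c / (2 + θ)) * (z - c)) := by
    rw [hzm, ← Real.exp_add]
    rw [show -w + -(2 * c / (2 + θ)) * (δ * m) = (m:ℝ) * (- Real.log (1 + θ)) by
      rw [hw, hθ]; ring]
    rw [Real.exp_nat_mul, Real.exp_neg, Real.exp_log (by positivity), one_div]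
  have hB1 := ecB_ge_one R hRp n
  have hden : 0 < ecB R n + 1 / θ := by positivity
  have hratio : (∑' j : ℕ, if z ≤ δ * ((j : ℝ) - R) then pi j else 0) / (∫ x in Set.Ici z, nu x)
      = A * Real.exp (-w) := by
    rw [hnum, htail z hcz, hpow]
    have hpin : pi n = 1 / (ecB R n + 1 / θ) := by rw [eq_div_iff hden.ne']; exact hd1
    have hvn : nu c * (δ * J + (2 + θ) / (2 * c)) = 1 := hJ
    have hvne := hv.ne'
    have hv1 : 1 / nu c = δ * J + (2 + θ) / (2 * c) := by rw [← hvn]; field_simp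
    have hE := Real.exp_pos (-(2 * c / (2 + θ)) * (z - c))
    calc pi n * (Real.exp (-w) * Real.exp (-(2 * c / (2 + θ)) * (z - c))) * ((1 + θ) / θ) /
          (nu c * Real.exp (-(2 * c / (2 + θ)) * (z - c)) * ((2 + θ) / (2 * c)))
        = pi n * Real.exp (-w) * ((1 + θ) / θ) * (1 / nu c) * ((2 * c) / (2 + θ)) := by
          field_simp
      _ = A * Real.exp (-w) := by
          rw [hv1, hpin, hAdef]
          have : δ = θ / c := by rw [hθ]; field_simp
          rw [this]
          field_simp
  rw [hratio]
  have hew1 : Real.exp (-w) ≤ 1 := Real.exp_le_one_iff.2 (by linarith)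
  have hew0 := Real.exp_pos (-w)
  have hmain : |A * Real.exp (-w) - 1| ≤ |A - 1| + (1 - Real.exp (-w)) := by
    have e1 : A * Real.exp (-w) - 1 = (A - 1) * Real.exp (-w) + -(1 - Real.exp (-w)) := by ring
    rw [e1]
    refine (abs_add_le _ _).trans ?_
    rw [abs_neg, abs_of_nonneg (by linarith : 0 ≤ 1 - Real.exp (-w)), abs_mul, abs_of_pos hew0]
    have := abs_nonneg (A - 1)
    nlinarith
  set E := δ ^ 2 + δ * θ + θ ^ 2 with hE
  have hE0 : 0 ≤ E := by positivity
  have hEδθ : δ * θ ≤ E := by rw [hE]; nlinarith [sq_nonneg δ, sq_nonneg θ]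
  have hXE : 1 / R + θ ^ 2 ≤ E := by
    rw [hE, ← hδ2']
    have : 0 ≤ δ * θ := by positivity
    linarith
  have hpart1 : 33000 * Real.exp (R * θ ^ 2) * (1 / R + θ ^ 2) ≤ 33000 * Real.exp (c ^ 2) * E := by
    rw [hRθ]; gcongr
  have hmin : 1 - Real.exp (-w) ≤ c ^ 2 * E * min (max z 1) (1 / δ ^ 2 * (1 / c + δ) ^ 3) := by
    rw [mul_min_of_nonneg _ _ (by positivity)]
    apply le_min
    · have h1 : 1 - Real.exp (-w) ≤ w := by linarith [Real.add_one_le_exp (-w)]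
      have h2 : (m:ℝ) * θ ^ 3 = c ^ 2 * (δ * θ) * (δ * m) := by rw [hθ]; ring
      have h3 : δ * (m:ℝ) ≤ max z 1 := le_trans (by linarith) (le_max_left z 1)
      calc 1 - Real.exp (-w) ≤ c ^ 2 * (δ * θ) * (δ * m) := by linarith
        _ ≤ c ^ 2 * E * max z 1 := by gcongr
    · have h1 : 1 - Real.exp (-w) ≤ 1 := by linarith
      have h2 : c ^ 2 * (δ * θ) * (1 / δ ^ 2 * (1 / c) ^ 3) = 1 := by rw [hθ]; field_simp
      have h3 : c ^ 2 * (δ * θ) * (1 / δ ^ 2 * (1 / c) ^ 3) ≤ c ^ 2 * E * (1 / δ ^ 2 * (1 / c + δ) ^ 3) := by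
        gcongr; linarith
      linarith
  have hMn : 0 ≤ c ^ 2 * E * min (max z 1) (1 / δ ^ 2 * (1 / c + δ) ^ 3) := by
    linarith
  have hpart2 : c ^ 2 * E * min (max z 1) (1 / δ ^ 2 * (1 / c + δ) ^ 3) ≤
      33000 * Real.exp (2 * c ^ 2) * c ^ 2 * E * min (max z 1) (1 / δ ^ 2 * (1 / c + δ) ^ 3) := by
    have h1 : 1 ≤ Real.exp (2 * c ^ 2) := Real.one_le_exp (by positivity)
    have h2 : 33000 * Real.exp (2 * c ^ 2) * c ^ 2 * E * min (max z 1) (1 / δ ^ 2 * (1 / c + δ) ^ 3)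
        = (33000 * Real.exp (2 * c ^ 2)) * (c ^ 2 * E * min (max z 1) (1 / δ ^ 2 * (1 / c + δ) ^ 3)) := by
      simp only [mul_assoc]
    rw [h2]
    exact le_mul_of_one_le_left hMn (by linarith)
  have hδsq := sq_nonneg δ
  linarith
end

section
/- In the Erlang-C setup with 0 < R < n, the scaled stationary customer count X̃(∞) satisfies all of the following moment bounds: (i) E[(X̃(∞))²·1(X̃(∞) ≤ −ζ)] ≤ 4/3 + 2δ²/3; (ii) E[|X̃(∞)|·1(X̃(∞) ≤ −ζ)] ≤ √(4/3 + 2δ²/3); (iii) E[|X̃(∞)|·1(X̃(∞) ≤ −ζ)] ≤ 2|ζ|; (iv) E[|X̃(∞)|·1(X̃(∞) ≥ −ζ)] ≤ 1/|ζ| + δ²/(4|ζ|) + δ/2; and (v) P(X̃(∞) ≤ −ζ) ≤ (2 + δ)·|ζ|. -/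
open MeasureTheory Set

theorem ec_A_s14 (R : ℝ) (n : ℕ) (p : ℕ → ℝ)
    (hf : ∀ k : ℕ, k < n → R * p k = ((k : ℝ) + 1) * p (k + 1)) (m : ℕ) (hm : m ≤ n) :
    ∑ k ∈ Finset.range (m + 1), p k * ((k : ℝ) - R) = - (R * p m) := by
  induction m with
  | zero => simp; ring
  | succ m ih =>
    rw [Finset.sum_range_succ, ih (by omega)]
    have := hf m (by omega)
    push_cast
    linear_combination -this

theorem ec_B (R : ℝ) (n : ℕ) (p : ℕ → ℝ)
    (hf : ∀ k : ℕ, k < n → R * p k = ((k : ℝ) + 1) * p (k + 1)) (m : ℕ) (hm : m ≤ n) :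
    ∑ k ∈ Finset.range (m + 1), p k * ((k : ℝ) - R) ^ 2 =
      R * ∑ k ∈ Finset.range (m + 1), p k - R * p m * (1 + m - R) := by
  induction m with
  | zero => simp; ring
  | succ m ih =>
    rw [Finset.sum_range_succ, ih (by omega), Finset.sum_range_succ _ (m + 1)]
    have := hf m (by omega)
    push_cast
    linear_combination (-(1 + (m : ℝ) - R)) * this

theorem ec_frac (a R S w v : ℝ) (hw : w ≠ 0) (hv : v ≠ 0) :
    R * (a * R / w) - (S * (a * R / v) + R) = R * (a * R * v - S * a * w - w * v) / (w * v) := by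
  field_simp
  ring

theorem ec_val (c d n R : ℝ) (hd : d ≠ 0) (hn : n ≠ 0) (h : d = n - R) :
    c * (d * (1 - R / n)⁻¹ + R / n / (1 - R / n) ^ 2) = c * n * (d ^ 2 + R) / d ^ 2 := by
  have e : 1 - R / n = d / n := by rw [h]; field_simp
  rw [e]
  clear e h
  field_simp

/-- Barrier function. -/
noncomputable def ecH (r y : ℝ) : ℝ :=
  if y ≤ 0 then max r (2 * r + 1 + y) else (2 * r + 1) * r ^ 2 / (r ^ 2 - (2 * r + 1) * y)

theorem ecH_step (r y : ℝ) (hr : 0 < r) (hy : -r ^ 2 ≤ y) (hy2 : (2 * r + 1) * y < r ^ 2) :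
    (r ^ 2 + y) * ecH r (y - 1) + r ^ 2 ≤ r ^ 2 * ecH r y := by
  unfold ecH
  by_cases h0 : y ≤ 0
  · rw [if_pos h0, if_pos (by linarith)]
    rcases le_total y (-r - 1) with h1 | h1
    · rw [max_eq_left (by linarith), max_eq_left (by linarith)]
      nlinarith
    · rw [max_eq_right (b := 2 * r + 1 + y) (by linarith)]
      rcases le_total y (-r) with h2 | h2
      · rw [max_eq_left (by linarith)]
        nlinarith [mul_nonneg (sq_nonneg r) (by linarith : 0 ≤ y + r + 1), mul_nonneg hr.le (by linarith : 0 ≤ -r - y)]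
      · rw [max_eq_right (by linarith)]
        nlinarith [mul_nonneg (by linarith : 0 ≤ -y) (by linarith : 0 ≤ 2 * r + y)]
  · rw [if_neg h0]
    push Not at h0
    have hw : 0 < r ^ 2 - (2 * r + 1) * y := by linarith
    by_cases h1 : y - 1 ≤ 0
    · rw [if_pos h1, max_eq_right (by linarith)]
      have key : (2 * r + 1) + (2 * r + 1) ^ 2 * y / r ^ 2 ≤
          (2 * r + 1) * r ^ 2 / (r ^ 2 - (2 * r + 1) * y) := by
        rw [le_div_iff₀ hw]
        have : (2 * r + 1 + (2 * r + 1) ^ 2 * y / r ^ 2) * (r ^ 2 - (2 * r + 1) * y)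
          = (2 * r + 1) * r ^ 2 - (2 * r + 1) ^ 3 * y ^ 2 / r ^ 2 := by
          field_simp; ring
        rw [this]
        have : 0 ≤ (2 * r + 1) ^ 3 * y ^ 2 / r ^ 2 := by positivity
        linarith
      have k2 := mul_le_mul_of_nonneg_left key (sq_nonneg r)
      have : r ^ 2 * ((2 * r + 1) + (2 * r + 1) ^ 2 * y / r ^ 2)
         = r ^ 2 * (2 * r + 1) + (2 * r + 1) ^ 2 * y := by field_simp
      rw [this] at k2
      refine le_trans ?_ k2
      nlinarith [mul_nonneg h0.le (by linarith : 0 ≤ 1 - y), mul_nonneg h0.le hr.le,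
        mul_nonneg h0.le (sq_nonneg r)]
    · rw [if_neg h1]
      have hw2 : 0 < r ^ 2 - (2 * r + 1) * (y - 1) := by nlinarith
      have e : r ^ 2 * ((2 * r + 1) * r ^ 2 / (r ^ 2 - (2 * r + 1) * y)) -
          ((r ^ 2 + y) * ((2 * r + 1) * r ^ 2 / (r ^ 2 - (2 * r + 1) * (y - 1))) + r ^ 2)
          = r ^ 2 * ((2 * r + 1) ^ 2 * r ^ 2 - (r ^ 2 - (2 * r + 1) * y) * (r ^ 2 + (2 * r + 1)))
            / ((r ^ 2 - (2 * r + 1) * y) * (r ^ 2 - (2 * r + 1) * (y - 1))) := by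
        rw [ec_frac _ _ _ _ _ hw.ne' hw2.ne']
        congr 1
        ring
      rw [← sub_nonneg, e]
      apply div_nonneg _ (by positivity)
      apply mul_nonneg (by positivity)
      have : (r ^ 2 - (2 * r + 1) * y) * (r ^ 2 + (2 * r + 1)) ≤ r ^ 2 * (r ^ 2 + (2 * r + 1)) :=
        mul_le_mul_of_nonneg_right (by nlinarith) (by positivity)
      nlinarith [mul_pos hr hr, mul_pos (mul_pos hr hr) hr, mul_pos (mul_pos hr hr) (mul_pos hr hr)]

theorem ec_C (r : ℝ) (hr : 0 < r) (n : ℕ) (p : ℕ → ℝ) (hp : ∀ k, 0 ≤ p k)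
    (hf : ∀ k : ℕ, k < n → r ^ 2 * p k = ((k : ℝ) + 1) * p (k + 1))
    (hd : (2 * r + 1) * ((n : ℝ) - r ^ 2) < r ^ 2) (m : ℕ) (hm : m ≤ n) :
    ∑ k ∈ Finset.range (m + 1), p k ≤ p m * ecH r ((m : ℝ) - r ^ 2) := by
  have hr2 : 0 < r ^ 2 := by positivity
  have hstep : ∀ m : ℕ, m ≤ n → (m : ℝ) * ecH r ((m : ℝ) - r ^ 2 - 1) + r ^ 2 ≤
      r ^ 2 * ecH r ((m : ℝ) - r ^ 2) := by
    intro m hm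
    have hmn : (m : ℝ) ≤ n := by exact_mod_cast hm
    have hm0 : (0 : ℝ) ≤ m := by positivity
    have := ecH_step r ((m : ℝ) - r ^ 2) hr (by linarith) (by nlinarith)
    simpa using this
  induction m with
  | zero =>
    have h := hstep 0 (by omega)
    have : 1 ≤ ecH r ((0 : ℕ) - r ^ 2) := by
      by_contra hc
      push Not at hc
      simp only [Nat.cast_zero] at h hc
      nlinarith
    have h2 := hp 0
    rw [Finset.sum_range_one]
    nlinarith
  | succ m ih =>
    rw [Finset.sum_range_succ]
    have i1 := ih (by omega)
    have h := hstep (m + 1) hm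
    have f := hf m (by omega)
    have e : ((m + 1 : ℕ) : ℝ) - r ^ 2 - 1 = (m : ℝ) - r ^ 2 := by push_cast; ring
    rw [e] at h
    have h3 := mul_le_mul_of_nonneg_left h (hp (m + 1))
    have i3 := mul_le_mul_of_nonneg_left i1 hr2.le
    have f3 : r ^ 2 * (p m * ecH r ((m : ℝ) - r ^ 2)) =
      ((m : ℝ) + 1) * p (m + 1) * ecH r ((m : ℝ) - r ^ 2) := by rw [← f]; ring
    refine le_of_mul_le_mul_left ?_ hr2
    push_cast at h3 ⊢
    nlinarith

set_option maxHeartbeats 1000000 in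
/-- Moment bounds for the scaled stationary Erlang-C customer count `X̃(∞)`
(Lemma on moment bounds for the Erlang-C model, `0 < R < n`). -/
theorem erlangC_moment_bounds
    (lam mu : ℝ) (n : ℕ)
    (hlam : 0 < lam) (hmu : 0 < mu) (hn : 1 ≤ n)
    (R δ ζ : ℝ)
    (hR : R = lam / mu) (hR0 : 0 < R) (hRn : R < (n : ℝ))
    (hδ : δ = 1 / Real.sqrt R) (hζ : ζ = δ * (R - (n : ℝ)))
    (pi : ℕ → ℝ)
    (hpi_nonneg : ∀ k, 0 ≤ pi k)
    (hpi_sum : (∑' k : ℕ, pi k) = 1)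
    (hflow : ∀ k : ℕ, lam * pi k = mu * min ((k : ℝ) + 1) (n : ℝ) * pi (k + 1))
    (X : ℕ → ℝ) (hX : ∀ k : ℕ, X k = δ * ((k : ℝ) - R)) :
    ((Summable fun k : ℕ => if X k ≤ -ζ then pi k * (X k) ^ 2 else 0) ∧
      (∑' k : ℕ, if X k ≤ -ζ then pi k * (X k) ^ 2 else 0) ≤ 4 / 3 + 2 * δ ^ 2 / 3) ∧
    ((∑' k : ℕ, if X k ≤ -ζ then pi k * |X k| else 0)
        ≤ Real.sqrt (4 / 3 + 2 * δ ^ 2 / 3)) ∧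
    ((∑' k : ℕ, if X k ≤ -ζ then pi k * |X k| else 0) ≤ 2 * |ζ|) ∧
    ((Summable fun k : ℕ => if -ζ ≤ X k then pi k * |X k| else 0) ∧
      (∑' k : ℕ, if -ζ ≤ X k then pi k * |X k| else 0)
        ≤ 1 / |ζ| + δ ^ 2 / (4 * |ζ|) + δ / 2) ∧
    ((∑' k : ℕ, if X k ≤ -ζ then pi k else 0) ≤ (2 + δ) * |ζ|) := by
  have hsum : Summable pi := by
    by_contra h
    rw [tsum_eq_zero_of_not_summable h] at hpi_sum
    norm_num at hpi_sum
  set r := Real.sqrt R with hrdef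
  have hr : 0 < r := Real.sqrt_pos.mpr hR0
  have hr2 : r ^ 2 = R := Real.sq_sqrt hR0.le
  have hδ0 : 0 < δ := by rw [hδ]; positivity
  have hδR : δ ^ 2 * R = 1 := by rw [hδ, ← hr2]; field_simp
  have hδr : δ * r = 1 := by rw [hδ]; field_simp
  have hflow' : ∀ k : ℕ, R * pi k = min ((k : ℝ) + 1) (n : ℝ) * pi (k + 1) := by
    intro k
    have := hflow k
    rw [hR, div_mul_eq_mul_div, this]
    field_simp
  have hf : ∀ k : ℕ, k < n → R * pi k = ((k : ℝ) + 1) * pi (k + 1) := by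
    intro k hk
    have hk' : (k : ℝ) + 1 ≤ n := by exact_mod_cast hk
    rw [hflow' k, min_eq_left hk']
  have hg : ∀ k : ℕ, n ≤ k → R * pi k = (n : ℝ) * pi (k + 1) := by
    intro k hk
    have hk' : (n : ℝ) ≤ k := by exact_mod_cast hk
    rw [hflow' k, min_eq_right (by linarith)]
  obtain ⟨d, hd⟩ : ∃ d : ℝ, d = (n : ℝ) - R := ⟨_, rfl⟩
  have hd0 : 0 < d := by linarith
  have hn0 : (0 : ℝ) < n := by linarith
  have hζd : -ζ = δ * d := by rw [hζ, hd]; ring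
  have hζa : |ζ| = δ * d := by
    rw [abs_of_neg, hζd]
    have : 0 < δ * d := by positivity
    linarith
  have hle : ∀ k : ℕ, X k ≤ -ζ ↔ k ≤ n := by
    intro k
    rw [hX, hζd, mul_le_mul_iff_right₀ hδ0, hd, sub_le_sub_iff_right, Nat.cast_le]
  have hge : ∀ k : ℕ, -ζ ≤ X k ↔ n ≤ k := by
    intro k
    rw [hX, hζd, mul_le_mul_iff_right₀ hδ0, hd, sub_le_sub_iff_right, Nat.cast_le]
  simp only [hle, hge]
  have hfin : ∀ g : ℕ → ℝ, HasSum (fun k : ℕ => if k ≤ n then g k else 0)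
      (∑ k ∈ Finset.range (n + 1), g k) := by
    intro g
    have h : ∑ k ∈ Finset.range (n + 1), g k =
        ∑ k ∈ Finset.range (n + 1), (if k ≤ n then g k else 0) := by
      apply Finset.sum_congr rfl
      intro k hk
      rw [if_pos (by simpa [Nat.lt_succ_iff] using hk)]
    rw [h]
    apply hasSum_sum_of_ne_finset_zero
    intro k hk
    rw [if_neg]
    simpa [Nat.lt_succ_iff] using hk
  rw [(hfin _).tsum_eq, (hfin _).tsum_eq, (hfin _).tsum_eq]
  obtain ⟨P, hP⟩ : ∃ P, P = ∑ k ∈ Finset.range (n + 1), pi k := ⟨_, rfl⟩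
  have hA := ec_A_s14 R n pi hf n le_rfl
  have hB := ec_B R n pi hf n le_rfl
  rw [← hP] at hB
  -- tail
  have htail : R * pi n = d * (1 - P) := by
    have h1 := hsum.sum_add_tsum_nat_add n
    have h2 := hsum.sum_add_tsum_nat_add (n + 1)
    rw [hpi_sum] at h1 h2
    rw [← hP] at h2
    rw [Finset.sum_range_succ] at hP
    have h3 : R * ∑' i, pi (i + n) = n * ∑' i, pi (i + (n + 1)) := by
      rw [← tsum_mul_left, ← tsum_mul_left]
      apply tsum_congr
      intro i
      exact hg (i + n) (by omega)
    have e1 : ∑' i, pi (i + n) = 1 - P + pi n := by linarith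
    have e2 : ∑' i, pi (i + (n + 1)) = 1 - P := by linarith
    rw [e1, e2] at h3
    rw [hd]
    linarith
  have hP0 : 0 ≤ P := by rw [hP]; exact Finset.sum_nonneg fun k _ => hpi_nonneg k
  have hP1 : P ≤ 1 := by
    rw [hP, ← hpi_sum]; exact hsum.sum_le_tsum _ fun k _ => hpi_nonneg k
  have hpn := hpi_nonneg n
  have hSq : ∑ k ∈ Finset.range (n + 1), pi k * X k ^ 2 ≤ 1 := by
    have : ∑ k ∈ Finset.range (n + 1), pi k * X k ^ 2 =
        δ ^ 2 * ∑ k ∈ Finset.range (n + 1), pi k * ((k : ℝ) - R) ^ 2 := by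
      rw [Finset.mul_sum]
      apply Finset.sum_congr rfl
      intro k _
      rw [hX]; ring
    rw [this, ← hδR]
    apply mul_le_mul_of_nonneg_left _ (sq_nonneg δ)
    rw [hB]
    have : 0 ≤ R * pi n * (1 + n - R) := mul_nonneg (by positivity) (by linarith)
    nlinarith
  have hAbs0 : 0 ≤ ∑ k ∈ Finset.range (n + 1), pi k * |X k| :=
    Finset.sum_nonneg fun k _ => mul_nonneg (hpi_nonneg k) (abs_nonneg _)
  refine ⟨⟨(hfin _).summable, ?_⟩, ?_, ?_, ?_, ?_⟩
  · nlinarith [sq_nonneg δ]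
  · -- weighted AM-GM
    have h1 : ∑ k ∈ Finset.range (n + 1), pi k * |X k| ≤ 1 := by
      have : ∑ k ∈ Finset.range (n + 1), pi k * |X k| ≤
          ∑ k ∈ Finset.range (n + 1), (pi k * X k ^ 2 + pi k) / 2 := by
        apply Finset.sum_le_sum
        intro k _
        have := mul_nonneg (hpi_nonneg k) (sq_nonneg (|X k| - 1))
        rw [← sq_abs (X k)]
        linarith
      rw [← Finset.sum_div, Finset.sum_add_distrib, ← hP] at this
      linarith
    refine h1.trans ?_
    rw [Real.le_sqrt' one_pos]
    nlinarith [sq_nonneg δ]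
  · have : ∑ k ∈ Finset.range (n + 1), pi k * |X k| ≤
        ∑ k ∈ Finset.range (n + 1), (2 * (δ * d) * pi k - δ * (pi k * ((k : ℝ) - R))) := by
      apply Finset.sum_le_sum
      intro k hk
      have hk' : (k : ℝ) ≤ n := by
        exact_mod_cast (by simpa [Nat.lt_succ_iff] using hk : k ≤ n)
      have hab : |X k| ≤ 2 * (δ * d) - δ * ((k : ℝ) - R) := by
        rw [hX, abs_le]
        constructor
        · nlinarith [mul_pos hδ0 hd0]
        · nlinarith
      have := mul_le_mul_of_nonneg_left hab (hpi_nonneg k)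
      linarith
    rw [Finset.sum_sub_distrib, ← Finset.mul_sum, ← Finset.mul_sum, hA, ← hP, htail] at this
    rw [hζa]
    have h2 : 0 ≤ δ * d * (1 - P) := mul_nonneg (by positivity) (by linarith)
    linarith
  · -- geometric tail
    have hgeo : ∀ j : ℕ, pi (j + n) = pi n * (R / n) ^ j := by
      intro j
      induction j with
      | zero => simp
      | succ j ih =>
        have := hg (j + n) (by omega)
        rw [ih] at this
        have e : j + 1 + n = j + n + 1 := by ring
        rw [e, pow_succ]
        field_simp
        field_simp at this
        linarith
    have hρ1 : R / n < 1 := by rw [div_lt_one hn0]; exact hRn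
    have hρ0 : 0 ≤ R / n := by positivity
    have hs1 := hasSum_geometric_of_lt_one hρ0 hρ1
    have hs2 := hasSum_coe_mul_geometric_of_norm_lt_one (r := R / (n : ℝ))
      (by rw [Real.norm_of_nonneg hρ0]; exact hρ1)
    have hs := ((hs1.mul_left d).add hs2).mul_left (δ * pi n)
    have hval : δ * pi n * (d * (1 - R / n)⁻¹ + R / n / (1 - R / n) ^ 2) =
        δ * pi n * n * (d ^ 2 + R) / d ^ 2 :=
      ec_val _ _ _ _ hd0.ne' hn0.ne' hd
    rw [hval] at hs
    have hs' : HasSum (fun j : ℕ => if n ≤ j + n then pi (j + n) * |X (j + n)| else 0)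
        (δ * pi n * n * (d ^ 2 + R) / d ^ 2) := by
      have hfun : (fun j : ℕ => if n ≤ j + n then pi (j + n) * |X (j + n)| else 0) =
          fun i : ℕ => δ * pi n * (d * (R / n) ^ i + (i : ℝ) * (R / n) ^ i) := by
        funext j
        rw [if_pos (by omega), hgeo, hX, abs_of_nonneg, hd]
        · push_cast; ring
        · apply mul_nonneg hδ0.le
          push_cast
          have : (0 : ℝ) ≤ j := by positivity
          linarith
      rw [hfun]; exact hs
    have hfull := (hasSum_nat_add_iff (f := fun k : ℕ => if n ≤ k then pi k * |X k| else 0) n).mp hs'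
    have hz : ∑ i ∈ Finset.range n, (if n ≤ i then pi i * |X i| else 0) = 0 := by
      apply Finset.sum_eq_zero
      intro i hi
      rw [if_neg]
      simpa using hi
    rw [hz, add_zero] at hfull
    refine ⟨hfull.summable, ?_⟩
    rw [hfull.tsum_eq, hζa]
    have hn1 : (n : ℝ) = d + R := by linarith
    have hlow : pi n * d ^ 2 ≤ R * P - R * pi n * (1 + d) := by
      have h1 : pi n * ((n : ℝ) - R) ^ 2 ≤
          ∑ k ∈ Finset.range (n + 1), pi k * ((k : ℝ) - R) ^ 2 :=
        Finset.single_le_sum (f := fun k : ℕ => pi k * ((k : ℝ) - R) ^ 2)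
          (fun k _ => mul_nonneg (hpi_nonneg k) (sq_nonneg _)) (by simp)
      rw [hB, ← hd] at h1
      have e : 1 + (n : ℝ) - R = 1 + d := by linarith
      rwa [e] at h1
    have hmain : pi n * n * (d ^ 2 + R) ≤ R * d := by
      rw [hn1]
      have := mul_le_mul_of_nonneg_left hlow hd0.le
      have t2 : R * pi n * (d ^ 2 + R) = d * (1 - P) * (d ^ 2 + R) := by rw [htail]
      have t3 : d * (R * pi n * (1 + d)) = d * (d * (1 - P) * (1 + d)) := by rw [htail]
      have t4 : d * (R * pi n) = d * (d * (1 - P)) := by rw [htail]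
      nlinarith
    have hfin1 : δ * pi n * n * (d ^ 2 + R) / d ^ 2 ≤ 1 / (δ * d) := by
      rw [div_le_div_iff₀ (by positivity) (by positivity)]
      have := mul_le_mul_of_nonneg_left hmain (by positivity : 0 ≤ δ ^ 2 * d)
      have e : δ ^ 2 * d * (R * d) = d ^ 2 := by linear_combination d ^ 2 * hδR
      rw [e] at this
      linarith
    have : 0 ≤ δ ^ 2 / (4 * (δ * d)) := by positivity
    linarith
  · rw [← hP, hζa]
    suffices h : R * P ≤ (2 * r + 1) * d by
      have h2 := mul_le_mul_of_nonneg_left h (sq_nonneg δ)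
      have e1 : δ ^ 2 * (R * P) = P := by linear_combination P * hδR
      have e2 : δ ^ 2 * ((2 * r + 1) * d) = (2 + δ) * (δ * d) := by
        linear_combination 2 * δ * d * hδr
      rwa [e1, e2] at h2
    by_cases hc : (2 * r + 1) * d < R
    · have hC := ec_C r hr n pi hpi_nonneg (by rw [hr2]; exact hf) (by rw [hr2, ← hd]; exact hc) n le_rfl
      rw [← hP, hr2, ← hd, ecH, if_neg (by linarith), hr2, ← mul_div_assoc,
        le_div_iff₀ (by linarith)] at hC
      have e : pi n * ((2 * r + 1) * R) = (2 * r + 1) * (d * (1 - P)) := by rw [← htail]; ring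
      rw [e] at hC
      linarith
    · push Not at hc
      nlinarith
end

section
/- In the Erlang-C setup with 0 < R < n, fix a 1-Lipschitz h : ℝ → ℝ with h(0) = 0 and define f_h′(x) := e^{−(1/μ)∫₀ˣ b(u) du}·∫_{−∞}^x (1/μ)·(E h(Y(∞)) − h(y))·e^{(1/μ)∫₀ʸ b(u) du} dy. Then f_h′ is continuously differentiable with absolutely continuous derivative f_h″, and: |f_h′(x)| ≤ (1/μ)(7.5 + 5/|ζ|) for x ≤ −ζ and |f_h′(x)| ≤ (1/(μ|ζ|))(x + 1 + 2/|ζ|) for x ≥ −ζ; |f_h″(x)| ≤ (34/μ)(1 + 1/|ζ|) for x ≤ −ζ and |f_h″(x)| ≤ 1/(μ|ζ|) for x ≥ −ζ; and at every x where the second derivative f_h‴ of f_h′ exists, |f_h‴(x)| ≤ (1/μ)(17 + 10/|ζ|) for x ≤ −ζ and |f_h‴(x)| ≤ 2/μ for x ≥ −ζ. -/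
open MeasureTheory Set

open Filter Topology in
theorem ec_ac_of_hasDerivAt {f f' : ℝ → ℝ} (hf : ∀ x, HasDerivAt f (f' x) x)
    (hc : Continuous f') (a b : ℝ) : AbsolutelyContinuousOnInterval f a b := by
  have h1 : ContDiff ℝ 1 f := by
    rw [contDiff_one_iff_deriv]
    refine ⟨fun x => (hf x).differentiableAt, ?_⟩
    have : deriv f = f' := funext fun x => (hf x).deriv
    rwa [this]
  obtain ⟨K, hK⟩ := (h1.locallyLipschitz.locallyLipschitzOn (s := uIcc a b)).exists_lipschitzOnWith_of_compact isCompact_uIcc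
  exact hK.absolutelyContinuousOnInterval

theorem ec_cmp {G Φ : ℝ → ℝ} (hG : ∀ a b, AbsolutelyContinuousOnInterval G a b)
    (hΦ : ∀ a b, AbsolutelyContinuousOnInterval Φ a b) {u v : ℝ} (huv : u ≤ v)
    (H : ∀ᵐ y : ℝ, u < y → y ≤ v → ∃ d e, HasDerivAt G d y ∧ HasDerivAt Φ e y ∧ |d| ≤ e) :
    |G v - G u| ≤ Φ v - Φ u := by
  rw [← (hG u v).integral_deriv_eq_sub, ← (hΦ u v).integral_deriv_eq_sub]
  have key := intervalIntegral.norm_integral_le_of_norm_le (f := deriv G) (g := deriv Φ) (μ := volume) huv ?_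
    (hΦ u v).intervalIntegrable_deriv
  · exact key
  filter_upwards [H] with y hy hyy
  obtain ⟨d, e, h1, h2, h3⟩ := hy hyy.1 hyy.2
  rw [h1.deriv, h2.deriv]
  exact h3

open Filter Topology in
theorem ec_cmp_bot {G Φ : ℝ → ℝ} (hG : ∀ a b, AbsolutelyContinuousOnInterval G a b)
    (hΦ : ∀ a b, AbsolutelyContinuousOnInterval Φ a b) {v : ℝ}
    (hG0 : Tendsto G atBot (𝓝 0)) (hΦ0 : Tendsto Φ atBot (𝓝 0))
    (H : ∀ᵐ y : ℝ, y ≤ v → ∃ d e, HasDerivAt G d y ∧ HasDerivAt Φ e y ∧ |d| ≤ e) :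
    |G v| ≤ Φ v := by
  have h1 : Tendsto (fun u => |G v - G u|) atBot (𝓝 |G v - 0|) :=
    (tendsto_const_nhds.sub hG0).abs
  have h2 : Tendsto (fun u => Φ v - Φ u) atBot (𝓝 (Φ v - 0)) := tendsto_const_nhds.sub hΦ0
  have := le_of_tendsto_of_tendsto h1 h2 (by
    filter_upwards [eventually_le_atBot v] with u hu
    exact ec_cmp hG hΦ hu (by filter_upwards [H] with y hy _ h using hy h))
  simpa using this

open Filter Topology in
theorem ec_cmp_top {G Φ : ℝ → ℝ} (hG : ∀ a b, AbsolutelyContinuousOnInterval G a b)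
    (hΦ : ∀ a b, AbsolutelyContinuousOnInterval Φ a b) {u : ℝ}
    (hG0 : Tendsto G atTop (𝓝 0)) (hΦ0 : Tendsto Φ atTop (𝓝 0))
    (H : ∀ᵐ y : ℝ, u < y → ∃ d e, HasDerivAt G d y ∧ HasDerivAt Φ e y ∧ |d| ≤ -e) :
    |G u| ≤ Φ u := by
  have h1 : Tendsto (fun v => |G v - G u|) atTop (𝓝 |0 - G u|) :=
    (hG0.sub tendsto_const_nhds).abs
  have h2 : Tendsto (fun v => (-Φ) v - (-Φ) u) atTop (𝓝 (-0 - (-Φ) u)) :=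
    hΦ0.neg.sub tendsto_const_nhds
  have := le_of_tendsto_of_tendsto h1 h2 (by
    filter_upwards [eventually_ge_atTop u] with v hv
    refine ec_cmp hG (fun a b => (hΦ a b).neg) hv ?_
    filter_upwards [H] with y hy h _
    obtain ⟨d, e, a1, a2, a3⟩ := hy h
    exact ⟨d, -e, a1, a2.neg, a3⟩)
  simpa using this

open Filter Topology in
/-- Normalised data of the problem (drift `-min x z`, unnormalised density `p`). -/
structure ECData (z M : ℝ) (p h G : ℝ → ℝ) : Prop where
  hz : 0 < z
  ppos : ∀ x, 0 < p x
  pd : ∀ x, HasDerivAt p (-(min x z) * p x) x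
  pbot : Tendsto (fun x => (1 + x ^ 2) * p x) atBot (𝓝 0)
  ptop : Tendsto (fun x => (1 + x ^ 2) * p x) atTop (𝓝 0)
  hM : |M| ≤ 1 + 1 / z
  lip : LipschitzWith 1 h
  h0 : h 0 = 0
  Gd : ∀ x, HasDerivAt G ((M - h x) * p x) x
  Gbot : Tendsto G atBot (𝓝 0)
  Gtop : Tendsto G atTop (𝓝 0)

namespace ECData
open Filter Topology
variable {z M : ℝ} {p h G : ℝ → ℝ}

theorem pcont (D : ECData z M p h G) : Continuous p :=
  continuous_iff_continuousAt.2 fun x => (D.pd x).continuousAt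

theorem Gcont (D : ECData z M p h G) : Continuous G :=
  continuous_iff_continuousAt.2 fun x => (D.Gd x).continuousAt

theorem pAC (D : ECData z M p h G) (a b : ℝ) : AbsolutelyContinuousOnInterval p a b := by
  have := D.pcont
  exact ec_ac_of_hasDerivAt D.pd (by fun_prop) a b

theorem GAC (D : ECData z M p h G) (a b : ℝ) : AbsolutelyContinuousOnInterval G a b := by
  have := D.pcont
  have := D.lip.continuous
  exact ec_ac_of_hasDerivAt D.Gd (by fun_prop) a b

theorem habs (D : ECData z M p h G) (x : ℝ) : |h x| ≤ |x| := by
  have := D.lip.dist_le_mul x 0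
  simpa [Real.dist_eq, D.h0] using this

theorem Mh (D : ECData z M p h G) (x : ℝ) : |M - h x| ≤ |M| + |x| :=
  (abs_sub M (h x)).trans (by linarith [D.habs x])

/-- growth-dominated multiples of `p` vanish at infinity -/
theorem tends (D : ECData z M p h G) {W : ℝ → ℝ} {l : Filter ℝ} (C : ℝ)
    (hl : Tendsto (fun x => (1 + x ^ 2) * p x) l (𝓝 0))
    (hW : ∀ᶠ x in l, |W x| ≤ C * (1 + x ^ 2)) : Tendsto (fun x => W x * p x) l (𝓝 0) := by
  refine squeeze_zero_norm' (a := fun x => C * ((1 + x ^ 2) * p x)) ?_ (by simpa using hl.const_mul C)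
  filter_upwards [hW] with x hx
  rw [norm_mul, Real.norm_eq_abs, Real.norm_eq_abs, abs_of_pos (D.ppos x), ← mul_assoc]
  exact mul_le_mul_of_nonneg_right hx (D.ppos x).le

/-- derivative of `W * p` -/
theorem Wd (D : ECData z M p h G) {W W' : ℝ → ℝ} (hW : ∀ x, HasDerivAt W (W' x) x) (x : ℝ) :
    HasDerivAt (fun x => W x * p x) ((W' x - min x z * W x) * p x) x := by
  exact ((hW x).mul (D.pd x)).congr_deriv (by ring)

theorem WAC (D : ECData z M p h G) {W W' : ℝ → ℝ} (hW : ∀ x, HasDerivAt W (W' x) x)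
    (hc : Continuous W') (a b : ℝ) :
    AbsolutelyContinuousOnInterval (fun x => W x * p x) a b := by
  have := D.pcont
  have : Continuous W := continuous_iff_continuousAt.2 fun x => (hW x).continuousAt
  exact ec_ac_of_hasDerivAt (D.Wd hW) (by fun_prop) a b

theorem dG_le (D : ECData z M p h G) (y : ℝ) {c : ℝ} (hc : |M| + |y| ≤ c) :
    |(M - h y) * p y| ≤ c * p y := by
  rw [abs_mul, abs_of_pos (D.ppos y)]
  exact mul_le_mul_of_nonneg_right ((D.Mh y).trans hc) (D.ppos y).le

theorem exp_aux {t : ℝ} (ht : 0 ≤ t) : 1 ≤ Real.exp (-t) * (1 + t) + t := by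
  have h1 := Real.add_one_le_exp (-t)
  have h2 := Real.exp_pos (-t)
  by_cases h : t ≤ 1
  · nlinarith
  · nlinarith

theorem gL (D : ECData z M p h G) {x : ℝ} (hx : x ≤ 0) :
    |G x| ≤ (|M| * (1 + Real.exp x) + 1) * p x := by
  have hW : ∀ x, HasDerivAt (fun x => |M| * (1 + Real.exp x) + 1) (|M| * Real.exp x) x := fun x => by
    exact (((Real.hasDerivAt_exp x).const_add 1).const_mul |M|).add_const 1
  refine ec_cmp_bot D.GAC (D.WAC hW (by fun_prop)) D.Gbot
    (D.tends (2 * |M| + 1) D.pbot ?_) (.of_forall fun y hy => ⟨_, _, D.Gd y, D.Wd hW y, ?_⟩)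
  · filter_upwards [eventually_le_atBot 0] with y hy
    have := Real.exp_le_one_iff.2 hy
    have := Real.exp_pos y
    have := abs_nonneg M
    rw [abs_of_nonneg (by positivity)]
    nlinarith [mul_nonneg this (sq_nonneg y), sq_nonneg y]
  · have hy0 : y ≤ 0 := hy.trans hx
    apply D.dG_le
    rw [min_eq_left (hy0.trans D.hz.le), abs_of_nonpos hy0]
    have := exp_aux (t := -y) (by linarith)
    rw [neg_neg] at this
    nlinarith [mul_le_mul_of_nonneg_left this (abs_nonneg M)]

theorem gM (D : ECData z M p h G) (hz1 : z ≤ 1) {x : ℝ} (hx : 0 ≤ x) (hxz : x ≤ z) :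
    |G x| ≤ (|M| * (2 + x + x ^ 2 + x ^ 3) + (1 + x ^ 2 + x ^ 4 / 2)) * p x := by
  have hW : ∀ x, HasDerivAt (fun x : ℝ => |M| * (2 + x + x ^ 2 + x ^ 3) + (1 + x ^ 2 + x ^ 4 / 2))
      (|M| * (1 + 2 * x + 3 * x ^ 2) + (2 * x + 2 * x ^ 3)) x := fun x => by
    exact HasDerivAt.congr_deriv ((((((hasDerivAt_id x).const_add 2).add (hasDerivAt_pow 2 x)).add
      (hasDerivAt_pow 3 x)).const_mul |M|).add
      (((hasDerivAt_pow 2 x).const_add 1).add ((hasDerivAt_pow 4 x).div_const 2))) (by norm_num; ring)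
  have h1 := ec_cmp D.GAC (D.WAC hW (by fun_prop)) hx
    (.of_forall fun y hy hyx => ⟨_, _, D.Gd y, D.Wd hW y, by
      apply D.dG_le
      rw [min_eq_left (hyx.trans hxz), abs_of_pos hy]
      have hy1 : y ≤ 1 := by linarith
      have e1 : 0 ≤ 2 * y ^ 2 - y ^ 3 - y ^ 4 := by
        have : 0 ≤ y ^ 2 * ((1 - y) * (2 + y)) := by
          have : 0 ≤ 1 - y := by linarith
          positivity
        nlinarith
      have e2 : 0 ≤ y ^ 3 - y ^ 5 / 2 := by
        have : 0 ≤ y ^ 3 * ((1 - y) * (1 + y) + 1) := by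
          have : 0 ≤ 1 - y := by linarith
          positivity
        nlinarith
      nlinarith [mul_nonneg (abs_nonneg M) e1]⟩)
  have h2 := D.gL le_rfl
  have h3 : |G x| ≤ |G x - G 0| + |G 0| := by
    simpa using abs_add_le (G x - G 0) (G 0)
  norm_num at h1 h2
  linarith

theorem gR (D : ECData z M p h G) (hz1 : 1 ≤ z) {x : ℝ} (hx : 0 ≤ x) :
    |G x| ≤ (|M| * (1 + Real.exp (-x) + 1 / z) + (2 + x ^ 2 / (2 * z ^ 2))) * p x := by
  have hz := D.hz
  have hW : ∀ x, HasDerivAt (fun x : ℝ => |M| * (1 + Real.exp (-x) + 1 / z) + (2 + x ^ 2 / (2 * z ^ 2)))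
      (|M| * (-Real.exp (-x)) + x / z ^ 2) x := fun x => by
    exact HasDerivAt.congr_deriv (((((hasDerivAt_neg x).exp.const_add 1).add_const (1 / z)).const_mul |M|).add
      (((hasDerivAt_pow 2 x).div_const (2 * z ^ 2)).const_add 2)) (by norm_num; field_simp)
  refine ec_cmp_top D.GAC (D.WAC hW (by fun_prop)) D.Gtop
    (D.tends (3 * |M| + 2) D.ptop ?_) (.of_forall fun y hy => ⟨_, _, D.Gd y, D.Wd hW y, ?_⟩)
  · filter_upwards [eventually_ge_atTop 0] with y hy
    have h1 : Real.exp (-y) ≤ 1 := Real.exp_le_one_iff.2 (by linarith)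
    have := Real.exp_pos (-y)
    have hM := abs_nonneg M
    have h2 : 1 / z ≤ 1 := by rw [div_le_one hz]; exact hz1
    have h3 : y ^ 2 / (2 * z ^ 2) ≤ y ^ 2 := div_le_self (by positivity) (by nlinarith)
    rw [abs_of_nonneg (by positivity)]
    have h4 : |M| * (1 + Real.exp (-y) + 1 / z) ≤ |M| * 3 :=
      mul_le_mul_of_nonneg_left (by linarith) hM
    nlinarith [mul_nonneg hM (sq_nonneg y), sq_nonneg y]
  · have hy0 : 0 < y := by linarith
    have he := Real.exp_pos (-y)
    rw [← neg_mul]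
    apply D.dG_le
    rw [abs_of_pos hy0]
    have hM := abs_nonneg M
    have hzz : 1 / z ^ 2 ≤ 1 := by rw [div_le_one (by positivity)]; nlinarith
    have hq : y / z ^ 2 ≤ y := div_le_self hy0.le (by nlinarith)
    rcases le_total y z with hyz | hyz
    · rw [min_eq_left hyz]
      have h1 := exp_aux hy0.le
      have h2 : 0 ≤ y * (1 / z) := by positivity
      have h3 : 0 ≤ y * (y ^ 2 / (2 * z ^ 2)) := by positivity
      nlinarith [mul_le_mul_of_nonneg_left h1 hM, mul_nonneg hM h2]
    · rw [min_eq_right hyz]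
      have h1 : z * (1 / z) = 1 := by field_simp
      have h2 : 0 ≤ Real.exp (-y) + z * (1 + Real.exp (-y)) := by positivity
      have h3 : 2 * y ≤ z * (2 + y ^ 2 / (2 * z ^ 2)) := by
        have : z * (2 + y ^ 2 / (2 * z ^ 2)) - 2 * y = (2 * z - y) ^ 2 / (2 * z) := by
          field_simp; ring
        have : 0 ≤ (2 * z - y) ^ 2 / (2 * z) := by positivity
        linarith
      nlinarith [mul_nonneg hM h2]

theorem gRR (D : ECData z M p h G) {x : ℝ} (hx : z ≤ x) :
    |G x| ≤ ((|M| + x) / z + 1 / z ^ 2) * p x := by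
  have hz := D.hz
  have hW : ∀ x, HasDerivAt (fun x : ℝ => (|M| + x) / z + 1 / z ^ 2) (1 / z) x := fun x => by
    exact (((hasDerivAt_id x).const_add |M|).div_const z).add_const (1 / z ^ 2)
  refine ec_cmp_top D.GAC (D.WAC hW (by fun_prop)) D.Gtop
    (D.tends ((|M| + 1) / z + 1 / z ^ 2) D.ptop ?_) (.of_forall fun y hy => ⟨_, _, D.Gd y, D.Wd hW y, ?_⟩)
  · filter_upwards [eventually_ge_atTop 0] with y hy
    have hM := abs_nonneg M
    rw [abs_of_nonneg (by positivity), add_mul]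
    refine add_le_add ?_ (le_mul_of_one_le_right (by positivity) (by nlinarith))
    rw [div_mul_eq_mul_div]
    gcongr
    nlinarith [mul_nonneg hM (sq_nonneg y), sq_nonneg (y - 1)]
  · rw [← neg_mul]
    apply D.dG_le
    have hy0 : 0 < y := by linarith
    rw [abs_of_pos hy0, min_eq_right (by linarith)]
    apply le_of_eq
    field_simp
    ring

theorem gB (D : ECData z M p h G) {x : ℝ} (hx : x ≤ z) : |G x| ≤ (7.5 + 5 / z) * p x := by
  have hz := D.hz
  have hM := D.hM
  have hM0 := abs_nonneg M
  have hp := (D.ppos x).le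
  have hi : 0 < 1 / z := by positivity
  have h5 : 5 / z = 5 * (1 / z) := by ring
  have h75 : (7.5 : ℝ) = 15 / 2 := by norm_num
  rw [h5, h75]
  rcases le_total x 0 with h0 | h0
  · refine (D.gL h0).trans (mul_le_mul_of_nonneg_right ?_ hp)
    have := Real.exp_le_one_iff.2 h0
    nlinarith
  rcases le_total z 1 with h1 | h1
  · refine (D.gM h1 h0 hx).trans (mul_le_mul_of_nonneg_right ?_ hp)
    have hx1 : x ≤ 1 := hx.trans h1
    have a2 : x ^ 2 ≤ 1 := pow_le_one₀ h0 hx1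
    have a3 : x ^ 3 ≤ 1 := pow_le_one₀ h0 hx1
    have a4 : x ^ 4 ≤ 1 := pow_le_one₀ h0 hx1
    have : |M| * (2 + x + x ^ 2 + x ^ 3) ≤ |M| * 5 := mul_le_mul_of_nonneg_left (by linarith) hM0
    linarith
  · refine (D.gR h1 h0).trans (mul_le_mul_of_nonneg_right ?_ hp)
    have e1 : Real.exp (-x) ≤ 1 := Real.exp_le_one_iff.2 (by linarith)
    have e2 : 1 / z ≤ 1 := by rw [div_le_one hz]; exact h1
    have e3 : x ^ 2 / (2 * z ^ 2) ≤ 1 := by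
      rw [div_le_one (by positivity)]; nlinarith
    have : |M| * (1 + Real.exp (-x) + 1 / z) ≤ |M| * 3 := mul_le_mul_of_nonneg_left (by linarith) hM0
    linarith


theorem hAC (D : ECData z M p h G) (a b : ℝ) :
    AbsolutelyContinuousOnInterval (fun x => M - h x) a b := by
  have h1 : LipschitzWith (0 + 1) (fun x => M - h x) := (LipschitzWith.const M).sub D.lip
  exact h1.lipschitzOnWith.absolutelyContinuousOnInterval

theorem minAC (z : ℝ) (a b : ℝ) : AbsolutelyContinuousOnInterval (fun x => min x z) a b := by
  have h1 : LipschitzWith 1 (fun x => min x z) := LipschitzWith.id.min_const z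
  exact h1.lipschitzOnWith.absolutelyContinuousOnInterval

theorem G2AC (D : ECData z M p h G) (a b : ℝ) :
    AbsolutelyContinuousOnInterval (fun x => (M - h x) * p x + min x z * G x) a b :=
  ((D.hAC a b).fun_mul (D.pAC a b)).fun_add ((minAC z a b).fun_mul (D.GAC a b))

theorem G2bot (D : ECData z M p h G) :
    Tendsto (fun x => (M - h x) * p x + min x z * G x) atBot (𝓝 0) := by
  have hz := D.hz
  have h2 := D.tends (W := fun x => M - h x + min x z * (G x / p x))
    (|M| + 1 + (7.5 + 5 / z)) D.pbot (by
      filter_upwards [eventually_le_atBot 0] with x hx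
      rw [min_eq_left (hx.trans D.hz.le)]
      have h1 : |G x / p x| ≤ 7.5 + 5 / z := by
        rw [abs_div, abs_of_pos (D.ppos x), div_le_iff₀ (D.ppos x)]
        exact D.gB (hx.trans D.hz.le)
      have hB : 0 ≤ 7.5 + 5 / z := by positivity
      have hx2 : |x| ≤ 1 + x ^ 2 := by nlinarith [sq_abs x, sq_nonneg (|x| - 1)]
      have h3 := abs_add_le (M - h x) (x * (G x / p x))
      rw [abs_mul] at h3
      have h4 : |x| * |G x / p x| ≤ (1 + x ^ 2) * (7.5 + 5 / z) := by gcongr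
      have := D.Mh x
      nlinarith [mul_nonneg (abs_nonneg M) (sq_nonneg x)])
  refine h2.congr fun x => ?_
  have := (D.ppos x).ne'
  field_simp

theorem G2top (D : ECData z M p h G) :
    Tendsto (fun x => (M - h x) * p x + min x z * G x) atTop (𝓝 0) := by
  have h1 := D.tends (W := fun x => M - h x) (|M| + 1) D.ptop (.of_forall fun x => by
      have hx2 : |x| ≤ 1 + x ^ 2 := by nlinarith [sq_abs x, sq_nonneg (|x| - 1)]
      have := D.Mh x
      nlinarith [mul_nonneg (abs_nonneg M) (sq_nonneg x)])
  have h2 : Tendsto (fun x => min x z * G x) atTop (𝓝 0) := by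
    have := D.Gtop.const_mul z
    rw [mul_zero] at this
    refine this.congr' ?_
    filter_upwards [eventually_ge_atTop z] with x hx
    rw [min_eq_right hx]
  simpa using h1.add h2

theorem hder (D : ECData z M p h G) (y : ℝ) : |deriv h y| ≤ 1 := by
  simpa using norm_deriv_le_of_lipschitz (x₀ := y) D.lip

theorem G2d_lt (D : ECData z M p h G) {y : ℝ} (hy : y < z) (hd : DifferentiableAt ℝ h y) :
    HasDerivAt (fun x => (M - h x) * p x + min x z * G x) (-deriv h y * p y + G y) y := by
  have hm : HasDerivAt (fun x => min x z) 1 y := (hasDerivAt_id y).congr_of_eventuallyEq (by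
    filter_upwards [Iio_mem_nhds hy] with x hx
    exact min_eq_left (le_of_lt hx))
  exact (((hd.hasDerivAt.const_sub M).mul (D.pd y)).add (hm.mul (D.Gd y))).congr_deriv (by ring)

theorem G2d_gt (D : ECData z M p h G) {y : ℝ} (hy : z < y) (hd : DifferentiableAt ℝ h y) :
    HasDerivAt (fun x => (M - h x) * p x + min x z * G x) (-deriv h y * p y) y := by
  have hm : HasDerivAt (fun x => min x z) 0 y := (hasDerivAt_const y z).congr_of_eventuallyEq (by
    filter_upwards [Ioi_mem_nhds hy] with x hx
    exact min_eq_right (le_of_lt hx))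
  exact (((hd.hasDerivAt.const_sub M).mul (D.pd y)).add (hm.mul (D.Gd y))).congr_deriv (by ring)

theorem G2_ae (D : ECData z M p h G) : ∀ᵐ y : ℝ, ∃ d,
    HasDerivAt (fun x => (M - h x) * p x + min x z * G x) d y ∧ |d| ≤ (8.5 + 5 / z) * p y ∧
      (z < y → |d| ≤ p y) := by
  have hne : ∀ᵐ y : ℝ, y ≠ z := by simp [ae_iff]
  filter_upwards [D.lip.ae_differentiableAt_real, hne] with y hd hy
  have hz := D.hz
  have hp := D.ppos y
  have h1 : |-deriv h y * p y| ≤ p y := by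
    rw [abs_mul, abs_neg, abs_of_pos hp]
    exact mul_le_of_le_one_left hp.le (D.hder y)
  rcases lt_or_gt_of_ne hy with hlt | hgt
  · refine ⟨_, D.G2d_lt hlt hd, ?_, fun h => absurd h hlt.not_gt⟩
    have h2 := abs_add_le (-deriv h y * p y) (G y)
    have h3 := D.gB hlt.le
    have : (8.5 + 5 / z) * p y = p y + (7.5 + 5 / z) * p y := by ring
    linarith
  · refine ⟨_, D.G2d_gt hgt hd, h1.trans ?_, fun _ => h1⟩
    have : 0 ≤ 5 / z := by positivity
    exact le_mul_of_one_le_left hp.le (by norm_num; linarith)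

theorem cd (c x : ℝ) : HasDerivAt (fun _ : ℝ => c) ((fun _ => 0) x) x := hasDerivAt_const x c

theorem xG2 (D : ECData z M p h G) {x : ℝ} (hx : x ≤ z) :
    |x| * |(M - h x) * p x + min x z * G x| ≤ (8.5 + 5 / z) * p x := by
  have hz := D.hz
  have hB : 0 ≤ 8.5 + 5 / z := by positivity
  have hl : ∀ (c : ℝ) (l : Filter ℝ), ∀ᶠ x : ℝ in l, |c| ≤ |c| * (1 + x ^ 2) := fun c l =>
    .of_forall fun x => le_mul_of_one_le_right (abs_nonneg c) (by nlinarith)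
  rcases lt_trichotomy x 0 with h0 | h0 | h0
  · have := ec_cmp_bot (v := x) D.G2AC (D.WAC (cd ((8.5 + 5 / z) / |x|)) (by fun_prop))
      D.G2bot (D.tends _ D.pbot (hl _ _)) (by
      filter_upwards [D.G2_ae] with y hy hyx
      obtain ⟨d, h1, h2, -⟩ := hy
      refine ⟨d, _, h1, D.Wd (cd _) y, h2.trans ?_⟩
      refine mul_le_mul_of_nonneg_right ?_ (D.ppos y).le
      rw [min_eq_left (hyx.trans hx), zero_sub, ← neg_mul, abs_of_neg h0, mul_div_assoc', le_div_iff₀ (by linarith)]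
      nlinarith)
    have hx' : 0 < |x| := abs_pos.2 h0.ne
    rw [div_mul_eq_mul_div, le_div_iff₀ hx'] at this
    linarith
  · subst h0
    simp only [abs_zero, zero_mul]
    have := D.ppos 0
    positivity
  · have := ec_cmp_top (u := x) D.G2AC (D.WAC (cd ((8.5 + 5 / z) / |x|)) (by fun_prop))
      D.G2top (D.tends _ D.ptop (hl _ _)) (by
      filter_upwards [D.G2_ae] with y hy hyx
      obtain ⟨d, h1, h2, -⟩ := hy
      refine ⟨d, _, h1, D.Wd (cd _) y, h2.trans ?_⟩
      rw [← neg_mul]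
      refine mul_le_mul_of_nonneg_right ?_ (D.ppos y).le
      rw [zero_sub, neg_neg, abs_of_pos h0, mul_div_assoc', le_div_iff₀ (by linarith)]
      have : x ≤ min y z := le_min hyx.le hx
      nlinarith)
    have hx' : 0 < |x| := abs_pos.2 h0.ne'
    rw [div_mul_eq_mul_div, le_div_iff₀ hx'] at this
    linarith

theorem G2R (D : ECData z M p h G) {x : ℝ} (hx : z ≤ x) :
    |(M - h x) * p x + min x z * G x| ≤ 1 / z * p x := by
  have hz := D.hz
  refine ec_cmp_top (u := x) D.G2AC (D.WAC (cd (1 / z)) (by fun_prop))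
      D.G2top (D.tends |1 / z| D.ptop (.of_forall fun x =>
        le_mul_of_one_le_right (abs_nonneg _) (by nlinarith))) ?_
  filter_upwards [D.G2_ae] with y hy hyx
  obtain ⟨d, h1, -, h2⟩ := hy
  refine ⟨d, _, h1, D.Wd (cd _) y, (h2 (by linarith)).trans ?_⟩
  rw [min_eq_right (by linarith)]
  have : z * (1 / z) = 1 := by field_simp
  rw [this]
  linarith

theorem within_le {h : ℝ → ℝ} (hL : LipschitzWith 1 h) {s : Set ℝ} {x d : ℝ} (hs : x ∉ s)
    [hN : (𝓝[s] x).NeBot] (hd : HasDerivWithinAt h d s x) : |d| ≤ 1 := by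
  rw [hasDerivWithinAt_iff_tendsto_slope' hs] at hd
  refine le_of_tendsto hd.abs (.of_forall fun y => ?_)
  rw [slope_def_field, abs_div]
  have := hL.dist_le_mul y x
  simp only [Real.dist_eq, NNReal.coe_one, one_mul] at this
  exact div_le_one_of_le₀ this (abs_nonneg _)

theorem main (D : ECData z M p h G) (g g1 : ℝ → ℝ) (hg : ∀ x, g x = (p x)⁻¹ * G x)
    (hg1 : ∀ x, g1 x = M - h x + min x z * g x) :
    (∀ x, HasDerivAt g (g1 x) x) ∧ Continuous g1 ∧
    (∀ a b, AbsolutelyContinuousOnInterval g1 a b) ∧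
    (∀ x, x ≤ z → |g x| ≤ 7.5 + 5 / z) ∧
    (∀ x, z ≤ x → |g x| ≤ 1 / z * (x + 1 + 2 / z)) ∧
    (∀ x, x ≤ z → |g1 x| ≤ 34 * (1 + 1 / z)) ∧
    (∀ x, z ≤ x → |g1 x| ≤ 1 / z) ∧
    (∀ x, x ≤ z → DifferentiableAt ℝ g1 x → |deriv g1 x| ≤ 17 + 10 / z) ∧
    (∀ x, z ≤ x → DifferentiableAt ℝ g1 x → |deriv g1 x| ≤ 2) := by
  have hz := D.hz
  have hgd : ∀ x, HasDerivAt g (g1 x) x := fun x => by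
    have hp := (D.ppos x).ne'
    have h1 := ((D.pd x).inv hp).mul (D.Gd x)
    have h2 : g = (p⁻¹ * G) := funext hg
    rw [hg1, hg, h2]
    refine h1.congr_deriv ?_
    simp only [Pi.inv_apply]
    field_simp
    ring
  have hgc : Continuous g := continuous_iff_continuousAt.2 fun x => (hgd x).continuousAt
  have hgG : ∀ x, |G x| = |g x| * p x := fun x => by
    have hp := D.ppos x
    rw [hg, abs_mul, abs_inv, abs_of_pos hp]
    field_simp
  have hg2 : ∀ x, |(M - h x) * p x + min x z * G x| = |g1 x| * p x := fun x => by
    have hp := D.ppos x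
    rw [← abs_of_pos hp, ← abs_mul, abs_of_pos hp, hg1, hg]
    congr 1
    field_simp
  have b1 : ∀ x, x ≤ z → |g x| ≤ 7.5 + 5 / z := fun x hx =>
    le_of_mul_le_mul_right (hgG x ▸ D.gB hx) (D.ppos x)
  have b4 : ∀ x, z ≤ x → |g1 x| ≤ 1 / z := fun x hx =>
    le_of_mul_le_mul_right (hg2 x ▸ D.G2R hx) (D.ppos x)
  have bx : ∀ x, x ≤ z → |x| * |g1 x| ≤ 8.5 + 5 / z := fun x hx => by
    have := D.xG2 hx
    rw [hg2, ← mul_assoc] at this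
    exact le_of_mul_le_mul_right this (D.ppos x)
  have hhc := D.lip.continuous
  have hg1c : Continuous g1 := by
    rw [show g1 = fun x => M - h x + min x z * g x from funext hg1]
    fun_prop
  refine ⟨hgd, hg1c, ?_, b1, ?_, ?_, b4, ?_, ?_⟩
  · intro a b
    rw [show g1 = fun x => M - h x + min x z * g x from funext hg1]
    exact (D.hAC a b).fun_add ((minAC z a b).fun_mul (ec_ac_of_hasDerivAt hgd hg1c a b))
  · intro x hx
    have h1 := le_of_mul_le_mul_right (hgG x ▸ D.gRR hx) (D.ppos x)
    refine h1.trans ?_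
    have : 1 / z * (x + 1 + 2 / z) = ((1 + 1 / z) + x) / z + 1 / z ^ 2 := by
      field_simp; ring
    rw [this]
    gcongr
    exact D.hM
  · intro x hx
    have hi : 0 < 1 / z := by positivity
    have h5 : 5 / z = 5 * (1 / z) := by ring
    have k1 := b1 x hx
    have k2 := bx x hx
    rw [h5] at k1 k2
    rcases le_total |x| 1 with h1 | h1
    · rw [hg1, min_eq_left hx]
      have e1 := abs_add_le (M - h x) (x * g x)
      have e2 := D.Mh x
      have e3 := D.hM
      rw [abs_mul] at e1
      have e4 : |x| * |g x| ≤ |g x| := mul_le_of_le_one_left (abs_nonneg _) h1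
      norm_num at *
      have hi' : 0 < z⁻¹ := inv_pos.2 hz
      linarith
    · have : |g1 x| ≤ |x| * |g1 x| := le_mul_of_one_le_left (abs_nonneg _) h1
      norm_num at *
      have hi' : 0 < z⁻¹ := inv_pos.2 hz
      linarith
  · intro x hx hd
    have h1 : HasDerivWithinAt h (g x + x * g1 x - deriv g1 x) (Iio x) x := by
      have h2 : HasDerivAt (fun y => M + y * g y - g1 y) (g x + x * g1 x - deriv g1 x) x :=
        ((((hasDerivAt_id x).mul (hgd x)).const_add M).sub hd.hasDerivAt).congr_deriv (by simp)
      refine h2.hasDerivWithinAt.congr (fun y hy => ?_) ?_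
      · rw [hg1, min_eq_left (le_of_lt (lt_of_lt_of_le hy hx))]; ring
      · rw [hg1, min_eq_left hx]; ring
    have h3 := within_le D.lip (by simp) h1
    have k1 := b1 x hx
    have k2 := bx x hx
    rw [← abs_mul] at k2
    have h5 : 10 / z = 2 * (5 / z) := by ring
    rw [h5]
    rw [abs_le] at *
    norm_num at *
    constructor <;> linarith
  · intro x hx hd
    have h1 : HasDerivWithinAt h (z * g1 x - deriv g1 x) (Ioi x) x := by
      have h2 : HasDerivAt (fun y => M + z * g y - g1 y) (z * g1 x - deriv g1 x) x :=
        ((((hgd x).const_mul z).const_add M).sub hd.hasDerivAt)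
      refine h2.hasDerivWithinAt.congr (fun y hy => ?_) ?_
      · rw [hg1, min_eq_right (le_of_lt (lt_of_le_of_lt hx hy))]; ring
      · rw [hg1, min_eq_right hx]; ring
    have h3 := within_le D.lip (by simp) h1
    have k := b4 x hx
    rw [le_div_iff₀ hz] at k
    have k2 : |z * g1 x| ≤ 1 := by rw [abs_mul, abs_of_pos hz]; linarith
    rw [abs_le] at *
    constructor <;> linarith

end ECData

theorem ec_int_min {z : ℝ} (hz : 0 < z) (x : ℝ) :
    z * |x| - z ^ 2 / 2 ≤ ∫ y in (0:ℝ)..x, min y z := by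
  have h1 : ∀ x, x ≤ z → ∫ y in (0:ℝ)..x, min y z = x ^ 2 / 2 := fun x hx => by
    rw [intervalIntegral.integral_congr (g := fun y => y) (fun y hy => ?_)]
    · simp
    · rw [mem_uIcc] at hy
      exact min_eq_left (by rcases hy with h | h <;> linarith)
  rcases le_total x z with hx | hx
  · rw [h1 x hx]
    nlinarith [sq_abs x, sq_nonneg (|x| - z)]
  · have hc : Continuous fun y : ℝ => min y z := by fun_prop
    rw [← intervalIntegral.integral_add_adjacent_intervals (hc.intervalIntegrable 0 z)
      (hc.intervalIntegrable z x), h1 z le_rfl,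
      intervalIntegral.integral_congr (a := z) (g := fun _ => z) (fun y hy => ?_)]
    · simp only [intervalIntegral.integral_const, smul_eq_mul]
      rw [abs_of_nonneg (hz.le.trans hx)]
      linarith
    · rw [uIcc_of_le hx] at hy
      exact min_eq_right hy.1

theorem ec_decay {z : ℝ} (hz : 0 < z) : ∃ K : ℝ, 0 ≤ K ∧ ∀ x : ℝ,
    (1 + x ^ 2) * Real.exp (-∫ y in (0:ℝ)..x, min y z) ≤ K * (1 + x ^ 2)⁻¹ := by
  refine ⟨Real.exp (z ^ 2 / 2) * (1 + 8 / z ^ 2) ^ 2, by positivity, fun x => ?_⟩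
  have h1 := ec_int_min hz x
  have h2 : 1 + x ^ 2 ≤ (1 + 8 / z ^ 2) * Real.exp (z * |x| / 2) := by
    have := Real.quadratic_le_exp_of_nonneg (x := z * |x| / 2) (by positivity)
    have h3 : 1 + z ^ 2 * x ^ 2 / 8 ≤ Real.exp (z * |x| / 2) := by
      have : 0 ≤ z * |x| / 2 := by positivity
      nlinarith [sq_abs x]
    refine le_trans ?_ (mul_le_mul_of_nonneg_left h3 (by positivity))
    have : (1 + 8 / z ^ 2) * (1 + z ^ 2 * x ^ 2 / 8) = 1 + x ^ 2 + (8 / z ^ 2 + z ^ 2 * x ^ 2 / 8) := by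
      field_simp
      ring
    rw [this]
    have : 0 ≤ 8 / z ^ 2 + z ^ 2 * x ^ 2 / 8 := by positivity
    linarith
  rw [← div_eq_mul_inv, le_div_iff₀ (by positivity)]
  calc (1 + x ^ 2) * Real.exp (-∫ y in (0:ℝ)..x, min y z) * (1 + x ^ 2)
      = (1 + x ^ 2) ^ 2 * Real.exp (-∫ y in (0:ℝ)..x, min y z) := by ring
    _ ≤ ((1 + 8 / z ^ 2) * Real.exp (z * |x| / 2)) ^ 2 * Real.exp (z ^ 2 / 2 - z * |x|) := by
        gcongr
        linarith
    _ = (1 + 8 / z ^ 2) ^ 2 * (Real.exp (z * |x| / 2) ^ 2 * Real.exp (z ^ 2 / 2 - z * |x|)) := by ring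
    _ = (1 + 8 / z ^ 2) ^ 2 * Real.exp (z ^ 2 / 2) := by
        rw [← Real.exp_nat_mul, ← Real.exp_add]
        congr 2
        push_cast
        ring
    _ = _ := by ring

open Filter Topology in
theorem ec_data {z M kappa : ℝ} {p h G : ℝ → ℝ} (hz : 0 < z)
    (hp : ∀ x, p x = Real.exp (-∫ y in (0:ℝ)..x, min y z))
    (hkappa : 0 < kappa) (hnorm : kappa * (∫ x, p x) = 1)
    (hLip : LipschitzWith 1 h) (h0 : h 0 = 0) (hM : M = kappa * ∫ x, h x * p x)
    (hG : ∀ x, G x = ∫ y in Iic x, (M - h y) * p y) : ECData z M p h G := by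
  have hmc : Continuous fun y : ℝ => min y z := by fun_prop
  have ppos : ∀ x, 0 < p x := fun x => by rw [hp]; exact Real.exp_pos _
  have pd : ∀ x, HasDerivAt p (-(min x z) * p x) x := fun x => by
    have h1 : HasDerivAt (fun x => ∫ y in (0:ℝ)..x, min y z) (min x z) x :=
      (hmc.integral_hasStrictDerivAt 0 x).hasDerivAt
    have h2 := h1.neg.exp
    rw [show p = fun x => Real.exp (-∫ y in (0:ℝ)..x, min y z) from funext hp]
    exact h2.congr_deriv (by rw [mul_comm]; rfl)
  have pc : Continuous p := continuous_iff_continuousAt.2 fun x => (pd x).continuousAt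
  have hc := hLip.continuous
  obtain ⟨K, hK0, hK⟩ := ec_decay hz
  simp only [← hp] at hK
  have hint : ∀ (W : ℝ → ℝ) (C : ℝ), Continuous W → (∀ x, |W x| ≤ C * (1 + x ^ 2)) →
      Integrable (fun x => W x * p x) := fun W C hW hb => by
    have hI : Integrable fun x : ℝ => |C| * (K * (1 + x ^ 2)⁻¹) :=
      (integrable_inv_one_add_sq.const_mul K).const_mul |C|
    refine hI.mono' (hW.mul pc).aestronglyMeasurable (.of_forall fun x => ?_)
    rw [norm_mul, Real.norm_eq_abs, Real.norm_eq_abs, abs_of_pos (ppos x)]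
    calc |W x| * p x ≤ (|C| * (1 + x ^ 2)) * p x := by
          refine mul_le_mul_of_nonneg_right ((hb x).trans ?_) (ppos x).le
          exact mul_le_mul_of_nonneg_right (le_abs_self C) (by positivity)
      _ = |C| * ((1 + x ^ 2) * p x) := by ring
      _ ≤ _ := mul_le_mul_of_nonneg_left (hK x) (abs_nonneg C)
  have ht : ∀ l : Filter ℝ, Tendsto (fun x : ℝ => |x|) l atTop →
      Tendsto (fun x => (1 + x ^ 2) * p x) l (𝓝 0) := fun l hl => by
    have h1 : Tendsto (fun x : ℝ => 1 + x ^ 2) l atTop :=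
      tendsto_atTop_mono (fun x => by nlinarith [sq_abs x, sq_nonneg (|x| - 1)]) hl
    have h2 := (tendsto_inv_atTop_zero.comp h1).const_mul K
    rw [mul_zero] at h2
    exact squeeze_zero (fun x => by have := ppos x; positivity) hK h2
  have pbot := ht atBot tendsto_abs_atBot_atTop
  have ptop := ht atTop tendsto_abs_atTop_atTop
  have hx1 : ∀ x : ℝ, |x| ≤ 1 + x ^ 2 := fun x => by nlinarith [sq_abs x, sq_nonneg (|x| - 1)]
  have habs : ∀ x, |h x| ≤ |x| := fun x => by
    have := hLip.dist_le_mul x 0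
    simpa [Real.dist_eq, h0] using this
  have hmin : ∀ x : ℝ, |min x z| ≤ |x| := fun x => by
    rcases le_total x z with hx | hx
    · rw [min_eq_left hx]
    · rw [min_eq_right hx, abs_of_pos hz]; exact hx.trans (le_abs_self x)
  have i1 : Integrable p := by
    simpa using hint (fun _ => 1) 1 (by fun_prop) (fun x => by simp; positivity)
  have ih : Integrable fun x => h x * p x := hint h 1 hc (fun x => by linarith [habs x, hx1 x])
  have ix : Integrable fun x => |x| * p x :=
    hint _ 1 (by fun_prop) (fun x => by rw [abs_abs]; linarith [hx1 x])
  have im : Integrable fun x => (x * min x z) * p x :=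
    hint _ 1 (by fun_prop) (fun x => by
      rw [abs_mul]
      nlinarith [hmin x, abs_nonneg x, sq_abs x])
  have htx : ∀ l : Filter ℝ, Tendsto (fun x => (1 + x ^ 2) * p x) l (𝓝 0) →
      Tendsto (fun x => x * p x) l (𝓝 0) := fun l hl => by
    refine squeeze_zero_norm (fun x => ?_) hl
    rw [norm_mul, Real.norm_eq_abs, Real.norm_eq_abs, abs_of_pos (ppos x)]
    exact mul_le_mul_of_nonneg_right (hx1 x) (ppos x).le
  have hstein : ∫ x, (x * min x z) * p x = ∫ x, p x := by
    have h1 := integral_of_hasDerivAt_of_tendsto (f := fun x => x * p x)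
      (f' := fun x => p x - (x * min x z) * p x)
      (fun x => ((hasDerivAt_id x).mul (pd x)).congr_deriv (by simp; ring)) (i1.sub im)
      (htx _ pbot) (htx _ ptop)
    rw [integral_sub i1 im] at h1
    linarith
  have hMb : |M| ≤ 1 + 1 / z := by
    rw [hM, abs_mul, abs_of_pos hkappa]
    have h1 : |∫ x, h x * p x| ≤ ∫ x, |x| * p x := by
      have key := norm_integral_le_of_norm_le (μ := volume) (f := fun x => h x * p x) ix
        (.of_forall fun x => ?_)
      · exact key
      rw [norm_mul, Real.norm_eq_abs, Real.norm_eq_abs, abs_of_pos (ppos x)]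
      exact mul_le_mul_of_nonneg_right (habs x) (ppos x).le
    have h2 : ∫ x, |x| * p x ≤ ∫ x, (1 / 2 * p x + (1 / 2 + 1 / z) * ((x * min x z) * p x)) := by
      refine integral_mono ix ((i1.const_mul _).add (im.const_mul _)) fun x => ?_
      have : |x| ≤ 1 / 2 + (1 / 2 + 1 / z) * (x * min x z) := by
        have hi : 0 < 1 / z := by positivity
        rcases le_total x z with hx | hx
        · rw [min_eq_left hx]
          nlinarith [sq_abs x, sq_nonneg (|x| - 1), mul_nonneg hi.le (mul_self_nonneg x)]
        · have hx0 : 0 < x := by linarith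
          rw [min_eq_right hx, abs_of_pos hx0]
          have : 1 / z * (x * z) = x := by field_simp
          nlinarith [mul_pos hx0 hz]
      have := mul_le_mul_of_nonneg_right this (ppos x).le
      simp only
      linarith
    rw [integral_add (i1.const_mul _) (im.const_mul _), integral_const_mul, integral_const_mul,
      hstein] at h2
    calc kappa * |∫ x, h x * p x| ≤ kappa * (1 / 2 * (∫ x, p x) + (1 / 2 + 1 / z) * ∫ x, p x) := by
          gcongr; exact h1.trans h2
      _ = (1 + 1 / z) * (kappa * ∫ x, p x) := by ring
      _ = _ := by rw [hnorm, mul_one]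
  have iF : Integrable fun x => (M - h x) * p x := by
    simp only [sub_mul]
    exact (i1.const_mul M).sub ih
  have hF0 : ∫ x, (M - h x) * p x = 0 := by
    simp only [sub_mul]
    rw [integral_sub (i1.const_mul M) ih, integral_const_mul]
    have h3 : kappa * (M * (∫ x, p x) - ∫ x, h x * p x) = 0 := by
      rw [mul_sub, ← hM]
      linear_combination M * hnorm
    exact (mul_eq_zero.1 h3).resolve_left hkappa.ne'
  have Gd : ∀ x, HasDerivAt G ((M - h x) * p x) x := fun x => by
    have h1 : HasDerivAt (fun x => ∫ y in (0:ℝ)..x, (M - h y) * p y) ((M - h x) * p x) x :=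
      ((show Continuous fun y => (M - h y) * p y by fun_prop).integral_hasStrictDerivAt 0 x).hasDerivAt
    refine (h1.const_add (G 0)).congr_of_eventuallyEq (.of_forall fun y => ?_)
    have := intervalIntegral.integral_Iic_sub_Iic (a := 0) (b := y) iF.integrableOn iF.integrableOn
    simp only [hG] at this ⊢
    linarith
  refine ⟨hz, ppos, pd, pbot, ptop, hMb, hLip, h0, Gd, ?_, ?_⟩
  · rw [show G = _ from funext hG]
    exact tendsto_integral_Iic_zero tendsto_id
  · have h1 : Tendsto (fun x : ℝ => -∫ y in Ioi x, (M - h y) * p y) atTop (𝓝 (-0)) :=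
      (tendsto_integral_Ioi_zero tendsto_id).neg
    rw [neg_zero] at h1
    refine h1.congr fun x => ?_
    have := integral_add_compl (measurableSet_Iic (a := x)) iF
    rw [hF0, compl_Iic] at this
    rw [hG]
    linarith

/-- Wasserstein gradient bounds for the Erlang-C model: the derivative `f′` of
the solution of the Poisson equation for a 1-Lipschitz test function `h` with
`h(0) = 0` is continuously differentiable with absolutely continuous derivative,
and satisfies explicit bounds on its first, second, and (where it exists)
third derivatives. -/
theorem erlangC_wasserstein_gradient_bounds
    (lam mu : ℝ) (n : ℕ)
    (hlam : 0 < lam) (hmu : 0 < mu) (hn : 1 ≤ n)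
    (R δ ζ : ℝ)
    (hR : R = lam / mu) (hR0 : 0 < R) (hRn : R < (n : ℝ))
    (hδ : δ = 1 / Real.sqrt R) (hζ : ζ = δ * (R - (n : ℝ)))
    (b : ℝ → ℝ)
    (hb : ∀ x : ℝ, b x = if x ≤ -ζ then -(mu * x) else mu * ζ)
    (p : ℝ → ℝ)
    (hp : ∀ x : ℝ, p x = Real.exp ((1 / mu) * ∫ y in (0:ℝ)..x, b y))
    (kappa : ℝ) (hkappa : 0 < kappa)
    (nu : ℝ → ℝ) (hnu : ∀ x : ℝ, nu x = kappa * p x)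
    (hnu_norm : (∫ x : ℝ, nu x) = 1)
    (h : ℝ → ℝ) (hLip : LipschitzWith 1 h) (h0 : h 0 = 0)
    (M : ℝ) (hM : M = ∫ x : ℝ, h x * nu x)
    (f' : ℝ → ℝ)
    (hf' : ∀ x : ℝ, f' x = (p x)⁻¹ * ∫ y in Set.Iic x, (1 / mu) * (M - h y) * p y) :
    ContDiff ℝ 1 f' ∧
    (∀ x y : ℝ, deriv f' y - deriv f' x = ∫ t in x..y, deriv (deriv f') t) ∧
    (∀ x : ℝ, x ≤ -ζ → |f' x| ≤ (1 / mu) * (7.5 + 5 / |ζ|)) ∧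
    (∀ x : ℝ, -ζ ≤ x → |f' x| ≤ (1 / (mu * |ζ|)) * (x + 1 + 2 / |ζ|)) ∧
    (∀ x : ℝ, x ≤ -ζ → |deriv f' x| ≤ (34 / mu) * (1 + 1 / |ζ|)) ∧
    (∀ x : ℝ, -ζ ≤ x → |deriv f' x| ≤ 1 / (mu * |ζ|)) ∧
    (∀ x : ℝ, x ≤ -ζ → DifferentiableAt ℝ (deriv f') x →
      |deriv (deriv f') x| ≤ (1 / mu) * (17 + 10 / |ζ|)) ∧
    (∀ x : ℝ, -ζ ≤ x → DifferentiableAt ℝ (deriv f') x →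
      |deriv (deriv f') x| ≤ 2 / mu) := by
  have hδ0 : 0 < δ := by rw [hδ]; positivity
  have hζ0 : ζ < 0 := by rw [hζ]; exact mul_neg_of_pos_of_neg hδ0 (by linarith)
  obtain ⟨z, rfl⟩ : ∃ z, ζ = -z := ⟨-ζ, by ring⟩
  have hz : 0 < z := by linarith
  clear hζ
  rw [abs_neg, abs_of_pos hz]
  simp only [neg_neg] at *
  have hb' : b = fun x => -(mu * min x z) := by
    funext x
    rw [hb]
    split_ifs with hx
    · rw [min_eq_left hx]
    · rw [min_eq_right (le_of_not_ge hx)]; ring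
  have hp' : ∀ x, p x = Real.exp (-∫ y in (0:ℝ)..x, min y z) := fun x => by
    rw [hp, hb', intervalIntegral.integral_neg, intervalIntegral.integral_const_mul]
    congr 1
    field_simp
  have hnorm : kappa * (∫ x, p x) = 1 := by
    rw [← integral_const_mul, ← hnu_norm]
    simp only [hnu]
  have hM' : M = kappa * ∫ x, h x * p x := by
    rw [hM, ← integral_const_mul]
    congr 1
    funext x
    rw [hnu]
    ring
  have D := ec_data (G := fun x => ∫ y in Iic x, (M - h y) * p y) hz hp' hkappa hnorm hLip h0 hM'
    (fun x => rfl)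
  set g : ℝ → ℝ := fun x => (p x)⁻¹ * ∫ y in Iic x, (M - h y) * p y with hg
  set g1 : ℝ → ℝ := fun x => M - h x + min x z * g x with hg1
  obtain ⟨hgd, hgc, hac, b1, b2, b3, b4, b5, b6⟩ := D.main g g1 (fun x => rfl) (fun x => rfl)
  have hf : f' = fun x => 1 / mu * g x := by
    funext x
    rw [hf', hg]
    simp only [mul_assoc]
    rw [integral_const_mul]
    ring
  have hfd : ∀ x, HasDerivAt f' (1 / mu * g1 x) x := fun x => by
    rw [hf]; exact (hgd x).const_mul _
  have hd1 : deriv f' = fun x => 1 / mu * g1 x := funext fun x => (hfd x).deriv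
  have hd2 : deriv (deriv f') = fun x => 1 / mu * deriv g1 x := by
    rw [hd1]; funext x; exact deriv_const_mul_field _
  have hmi : 0 < 1 / mu := by positivity
  have hdiff : ∀ x, DifferentiableAt ℝ (deriv f') x → DifferentiableAt ℝ g1 x := fun x hx => by
    have h1 := hx.const_mul mu
    refine h1.congr_of_eventuallyEq (.of_forall fun y => ?_)
    rw [hd1]
    field_simp
  have hab : ∀ t : ℝ, |1 / mu * t| = 1 / mu * |t| := fun t => by
    rw [abs_mul, abs_of_pos hmi]
  refine ⟨?_, ?_, ?_, ?_, ?_, ?_, ?_, ?_⟩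
  · rw [contDiff_one_iff_deriv, hd1]
    exact ⟨fun x => (hfd x).differentiableAt, by fun_prop⟩
  · intro x y
    rw [hd2, intervalIntegral.integral_const_mul, (hac x y).integral_deriv_eq_sub, hd1]
    ring
  · intro x hx
    rw [hf, hab]
    exact mul_le_mul_of_nonneg_left (b1 x hx) hmi.le
  · intro x hx
    rw [hf, hab]
    refine (mul_le_mul_of_nonneg_left (b2 x hx) hmi.le).trans (le_of_eq ?_)
    field_simp
  · intro x hx
    rw [hd1, hab]
    refine (mul_le_mul_of_nonneg_left (b3 x hx) hmi.le).trans (le_of_eq ?_)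
    ring
  · intro x hx
    rw [hd1, hab]
    refine (mul_le_mul_of_nonneg_left (b4 x hx) hmi.le).trans (le_of_eq ?_)
    field_simp
  · intro x hx hd
    rw [hd2, hab]
    exact mul_le_mul_of_nonneg_left (b5 x hx (hdiff x hd)) hmi.le
  · intro x hx hd
    rw [hd2, hab]
    refine (mul_le_mul_of_nonneg_left (b6 x hx (hdiff x hd)) hmi.le).trans (le_of_eq ?_)
    ring
end

section
/- In the Erlang-C setup with 1 ≤ R < n, the scaled stationary customer count X̃(∞) satisfies: (i) (1 + 1/|ζ|)·E[|X̃(∞)|·1(X̃(∞) ≤ −ζ)] ≤ √2 + 2; (ii) (1 + 1/|ζ|)·E[(X̃(∞))²·1(X̃(∞) ≤ −ζ)] ≤ 9; (iii) |ζ|·P(X̃(∞) ≥ −ζ) ≤ 2; and (iv) ζ²·P(X̃(∞) ≥ −ζ) ≤ 20. -/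
open MeasureTheory Set

set_option maxHeartbeats 4000000

lemma ec_stein (n : ℕ) (R : ℝ) (p : ℕ → ℝ)
    (h : ∀ k, k + 1 ≤ n → ((k : ℝ) + 1) * p (k + 1) = R * p k) (f : ℕ → ℝ) :
    ∀ N, N ≤ n → ∑ k ∈ Finset.range (N + 1), p k * (R * f (k + 1) - k * f k)
      = R * p N * f (N + 1) := by
  intro N
  induction N with
  | zero => intro _; simp; ring
  | succ N ih =>
    intro hN
    rw [Finset.sum_range_succ, ih (by omega)]
    have := h N hN
    push_cast
    linear_combination (-f (N + 1)) * this

lemma ec_core (n : ℕ) (R s : ℝ) (p : ℕ → ℝ) (hs : 1 ≤ s) (hR : R = s ^ 2) (hRn : R < n)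
    (hp : ∀ k, 0 ≤ p k)
    (h : ∀ k, k + 1 ≤ n → ((k : ℝ) + 1) * p (k + 1) = R * p k)
    (T P A B : ℝ) (hT : (n : ℝ) * T = n * p n + R * T)
    (hP : P = ∑ k ∈ Finset.range (n + 1), p k)
    (hA : A = ∑ k ∈ Finset.range (n + 1), p k * |(k : ℝ) - R|)
    (hB : B = ∑ k ∈ Finset.range (n + 1), p k * ((k : ℝ) - R) ^ 2)
    (hPT : P + T - p n = 1) (hT1 : p n ≤ T) :
    0 ≤ A ∧ 0 ≤ B ∧ P ≤ 1 ∧ B ≤ R * P ∧ A ≤ 2 * (n - R) ∧ A ≤ s ∧ n * p n ≤ n - R ∧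
      (n - R ≤ s → R * P ≤ 2 * s * A + R * p n * (n + 1 - R)) ∧
      R * p n ≤ A ∧ p n * (n + 1 - R) ≤ 1 ∧ p n * (n - R) ^ 2 ≤ B := by
  have hR0 : 0 < R := by rw [hR]; positivity
  have hpn := hp n
  have hA0 : 0 ≤ A := by
    rw [hA]; exact Finset.sum_nonneg fun k _ => mul_nonneg (hp k) (abs_nonneg _)
  have hB0 : 0 ≤ B := by
    rw [hB]; exact Finset.sum_nonneg fun k _ => mul_nonneg (hp k) (sq_nonneg _)
  have hP0 : 0 ≤ P := by
    rw [hP]; exact Finset.sum_nonneg fun k _ => hp k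
  have hP1 : P ≤ 1 := by linarith
  have hTle : T ≤ 1 := by
    have : p n ≤ P := by
      rw [hP]
      exact Finset.single_le_sum (f := p) (fun k _ => hp k) (Finset.mem_range.2 (Nat.lt_succ_self n))
    linarith
  have hb := ec_stein n R p h (fun _ => 1) n le_rfl
  have hc := ec_stein n R p h (fun k => (k : ℝ) - R) n le_rfl
  have hc' : B = R * P - R * p n * (n + 1 - R) := by
    have e : R * P - B = ∑ k ∈ Finset.range (n + 1), p k * (R * (((k + 1 : ℕ) : ℝ) - R) - k * ((k : ℝ) - R)) := by
      rw [hP, hB, Finset.mul_sum, ← Finset.sum_sub_distrib]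
      refine Finset.sum_congr rfl fun k _ => ?_
      push_cast; ring
    rw [hc] at e
    push_cast at e
    linarith
  have hBP : B ≤ R * P := by
    have : 0 ≤ R * p n * (n + 1 - R) := by
      apply mul_nonneg (by positivity); linarith
    linarith
  have hq : p n * (n + 1 - R) ≤ 1 := by
    have : R * (p n * (n + 1 - R)) ≤ R * 1 := by nlinarith
    exact le_of_mul_le_mul_left this hR0
  refine ⟨hA0, hB0, hP1, hBP, ?_, ?_, by nlinarith, ?_, ?_, hq, ?_⟩
  · have e : A ≤ R * p n * 1 + 2 * (n - R) * P := by
      rw [← hb, hA, hP, Finset.mul_sum, ← Finset.sum_add_distrib]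
      refine Finset.sum_le_sum fun k hk => ?_
      have hk' : (k : ℝ) ≤ n := by
        have := Finset.mem_range.1 hk
        exact_mod_cast (by omega : k ≤ n)
      have : |(k : ℝ) - R| ≤ (R * 1 - k * 1) + 2 * (n - R) := by
        rw [abs_le]; constructor <;> linarith
      linarith [mul_le_mul_of_nonneg_left this (hp k)]
    have : R * p n = (n - R) * (1 - P) := by
      have : T = 1 - P + p n := by linarith
      rw [this] at hT; linarith
    rw [this] at e
    nlinarith
  · have e : 2 * s * A ≤ B + R * P := by
      rw [hA, hB, hP, Finset.mul_sum, Finset.mul_sum, ← Finset.sum_add_distrib]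
      refine Finset.sum_le_sum fun k hk => ?_
      have : 2 * s * |(k : ℝ) - R| ≤ ((k : ℝ) - R) ^ 2 + R := by
        rw [← sq_abs ((k : ℝ) - R)]
        nlinarith [sq_nonneg (|(k : ℝ) - R| - s)]
      linarith [mul_le_mul_of_nonneg_left this (hp k)]
    have : s * A ≤ s * s := by nlinarith
    exact le_of_mul_le_mul_left this (by linarith)
  · intro hns
    have hf := ec_stein n R p h (fun k => max ((k : ℝ) - R) (-s)) n le_rfl
    have e : R * P ≤ 2 * s * A + R * p n * max (((n + 1 : ℕ) : ℝ) - R) (-s) := by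
      rw [← hf, hA, hP, Finset.mul_sum, Finset.mul_sum, ← Finset.sum_add_distrib]
      refine Finset.sum_le_sum fun k hk => ?_
      have hk' : (k : ℝ) ≤ n := by
        have := Finset.mem_range.1 hk
        exact_mod_cast (by omega : k ≤ n)
      have : R ≤ 2 * s * |(k : ℝ) - R| + (R * max (((k + 1 : ℕ) : ℝ) - R) (-s)
          - k * max ((k : ℝ) - R) (-s)) := by
        push_cast
        generalize (k : ℝ) = x at *
        by_cases hx : -s ≤ x - R
        · rw [max_eq_left hx, max_eq_left (by linarith)]
          have h1 : |x - R| ≤ s := abs_le.2 ⟨hx, by linarith⟩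
          nlinarith [sq_abs (x - R), abs_nonneg (x - R)]
        · push Not at hx
          rw [max_eq_right hx.le, abs_of_neg (by linarith)]
          nlinarith [le_max_right (x + 1 - R) (-s)]
      linarith [mul_le_mul_of_nonneg_left this (hp k)]
    rw [max_eq_left (by push_cast; linarith)] at e
    push_cast at e
    exact e
  · have : R * p n * 1 ≤ A := by
      rw [← hb, hA]
      refine Finset.sum_le_sum fun k hk => ?_
      apply mul_le_mul_of_nonneg_left _ (hp k)
      have := neg_abs_le ((k : ℝ) - R)
      linarith
    linarith
  · rw [hB]
    exact Finset.single_le_sum (f := fun k : ℕ => p k * ((k : ℝ) - R) ^ 2)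
      (fun k _ => mul_nonneg (hp k) (sq_nonneg _)) (Finset.mem_range.2 (Nat.lt_succ_self n))

lemma ec_tsum (n : ℕ) (g : ℕ → ℝ) (c : ℕ → Prop) [DecidablePred c] (hc : ∀ k, c k ↔ k ≤ n) :
    (∑' k, if c k then g k else 0) = ∑ k ∈ Finset.range (n + 1), g k := by
  rw [tsum_eq_sum (s := Finset.range (n + 1))]
  · refine Finset.sum_congr rfl fun k hk => ?_
    rw [if_pos]
    rw [hc]; have := Finset.mem_range.1 hk; omega
  · intro k hk
    rw [if_neg]
    rw [hc]; rw [Finset.mem_range] at hk; omega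

/-- Further moment bounds for the scaled stationary Erlang-C customer count
`X̃(∞)` under `1 ≤ R < n`. -/
theorem erlangC_further_moment_bounds
    (lam mu : ℝ) (n : ℕ)
    (hlam : 0 < lam) (hmu : 0 < mu) (hn : 1 ≤ n)
    (R δ ζ : ℝ)
    (hR : R = lam / mu) (hR1 : 1 ≤ R) (hRn : R < (n : ℝ))
    (hδ : δ = 1 / Real.sqrt R) (hζ : ζ = δ * (R - (n : ℝ)))
    (pi : ℕ → ℝ)
    (hpi_nonneg : ∀ k, 0 ≤ pi k)
    (hpi_sum : (∑' k : ℕ, pi k) = 1)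
    (hflow : ∀ k : ℕ, lam * pi k = mu * min ((k : ℝ) + 1) (n : ℝ) * pi (k + 1))
    (X : ℕ → ℝ) (hX : ∀ k : ℕ, X k = δ * ((k : ℝ) - R)) :
    ((1 + 1 / |ζ|) * (∑' k : ℕ, if X k ≤ -ζ then pi k * |X k| else 0)
        ≤ Real.sqrt 2 + 2) ∧
    ((1 + 1 / |ζ|) * (∑' k : ℕ, if X k ≤ -ζ then pi k * (X k) ^ 2 else 0) ≤ 9) ∧
    (|ζ| * (∑' k : ℕ, if -ζ ≤ X k then pi k else 0) ≤ 2) ∧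
    (ζ ^ 2 * (∑' k : ℕ, if -ζ ≤ X k then pi k else 0) ≤ 20) := by
  have hsum : Summable pi := by
    by_contra hns
    rw [tsum_eq_zero_of_not_summable hns] at hpi_sum
    norm_num at hpi_sum
  have hR0 : 0 < R := by linarith
  set s := Real.sqrt R with hsdef
  have hs1 : 1 ≤ s := Real.one_le_sqrt.2 hR1
  have hs0 : 0 < s := by linarith
  have hRs : R = s ^ 2 := (Real.sq_sqrt hR0.le).symm
  have hlamR : lam = mu * R := by rw [hR]; field_simp
  have hflow' : ∀ k : ℕ, R * pi k = min ((k : ℝ) + 1) (n : ℝ) * pi (k + 1) := by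
    intro k
    have := hflow k
    rw [hlamR] at this
    apply mul_left_cancel₀ hmu.ne'
    linarith
  have hle : ∀ k : ℕ, X k ≤ -ζ ↔ k ≤ n := by
    intro k
    have hd : 0 < δ := by rw [hδ]; positivity
    rw [hX, hζ, show -(δ * (R - (n : ℝ))) = δ * (n - R) by ring, mul_le_mul_iff_right₀ hd]
    rw [sub_le_sub_iff_right, Nat.cast_le]
  have hge : ∀ k : ℕ, -ζ ≤ X k ↔ n ≤ k := by
    intro k
    have hd : 0 < δ := by rw [hδ]; positivity
    rw [hX, hζ, show -(δ * (R - (n : ℝ))) = δ * (n - R) by ring, mul_le_mul_iff_right₀ hd]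
    rw [sub_le_sub_iff_right, Nat.cast_le]
  have hTs : (∑' k : ℕ, if -ζ ≤ X k then pi k else 0) = ∑' j : ℕ, pi (j + n) := by
    have hsm : Summable (fun k : ℕ => if -ζ ≤ X k then pi k else 0) := by
      refine Summable.of_nonneg_of_le (fun k => ?_) (fun k => ?_) hsum
      · split_ifs <;> simp [hpi_nonneg]
      · split_ifs <;> simp [hpi_nonneg]
    rw [← hsm.sum_add_tsum_nat_add n]
    rw [Finset.sum_eq_zero, zero_add]
    · refine tsum_congr fun j => ?_
      rw [if_pos]; rw [hge]; omega
    · intro k hk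
      rw [if_neg]; rw [hge]; have := Finset.mem_range.1 hk; omega
  have hsn : Summable (fun j : ℕ => pi (j + n)) := (summable_nat_add_iff n).2 hsum
  have hTrec : (∑' j : ℕ, pi (j + n)) = pi n + ∑' j : ℕ, pi (j + 1 + n) := by
    rw [hsn.tsum_eq_zero_add]; simp
  have hT : (n : ℝ) * (∑' j : ℕ, pi (j + n)) = n * pi n + R * (∑' j : ℕ, pi (j + n)) := by
    have : R * (∑' j : ℕ, pi (j + n)) = n * ∑' j : ℕ, pi (j + 1 + n) := by
      rw [← tsum_mul_left, ← tsum_mul_left]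
      refine tsum_congr fun j => ?_
      rw [hflow', min_eq_right, show j + n + 1 = j + 1 + n by omega]
      push_cast
      have : (0 : ℝ) ≤ j := Nat.cast_nonneg j
      linarith
    rw [this, ← mul_add, ← hTrec]
  have hPT : (∑ k ∈ Finset.range (n + 1), pi k) + (∑' j : ℕ, pi (j + n)) - pi n = 1 := by
    rw [Finset.sum_range_succ, ← hpi_sum, ← hsum.sum_add_tsum_nat_add n]; ring
  have hT1 : pi n ≤ ∑' j : ℕ, pi (j + n) := by
    rw [hTrec]
    have : 0 ≤ ∑' j : ℕ, pi (j + 1 + n) := tsum_nonneg fun j => hpi_nonneg _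
    linarith
  have hS1 : (∑' k : ℕ, if X k ≤ -ζ then pi k * |X k| else 0)
      = (∑ k ∈ Finset.range (n + 1), pi k * |(k : ℝ) - R|) / s := by
    rw [ec_tsum n _ _ hle, Finset.sum_div]
    refine Finset.sum_congr rfl fun k _ => ?_
    rw [hX, hδ, abs_mul, abs_of_pos (by positivity : 0 < 1 / s)]; ring
  have hS2 : (∑' k : ℕ, if X k ≤ -ζ then pi k * (X k) ^ 2 else 0)
      = (∑ k ∈ Finset.range (n + 1), pi k * ((k : ℝ) - R) ^ 2) / R := by
    rw [ec_tsum n _ _ hle, Finset.sum_div]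
    refine Finset.sum_congr rfl fun k _ => ?_
    rw [hX, hδ, mul_pow, div_pow, ← hRs]; ring
  have hcore := ec_core n R s pi hs1 hRs hRn hpi_nonneg (fun k hk => by
    rw [hflow' k, min_eq_left]; exact_mod_cast hk) _ _ _ _ hT rfl rfl rfl hPT hT1
  rw [hS1, hS2, hTs]
  generalize (∑ k ∈ Finset.range (n + 1), pi k * |(k : ℝ) - R|) = A at *
  generalize (∑ k ∈ Finset.range (n + 1), pi k * ((k : ℝ) - R) ^ 2) = B at *
  generalize (∑ k ∈ Finset.range (n + 1), pi k) = P at *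
  generalize (∑' j : ℕ, pi (j + n)) = T at *
  obtain ⟨hA0, hB0, hP1, hBP, hA2, hAs, hnp, hRP, hRpA, hq, hpB⟩ := hcore
  have hp := hpi_nonneg n
  generalize pi n = p at *
  obtain ⟨z, hz⟩ : ∃ z, z = ((n : ℝ) - R) / s := ⟨_, rfl⟩
  have hz0 : 0 < z := by rw [hz]; apply div_pos <;> linarith
  have hzs : (n : ℝ) - R = z * s := by rw [hz]; field_simp
  have hζz : ζ = -z := by rw [hζ, hδ, hz]; ring
  have habs : |ζ| = z := by rw [hζz, abs_neg, abs_of_pos hz0]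
  rw [habs]
  have hzT : z * T = n * p / s := by
    rw [eq_div_iff hs0.ne']
    linear_combination hT - T * hzs
  have hnps : n * p = R * p + p * (n - R) := by ring
  have hzT2 : z * T ≤ 2 := by
    rw [hzT, div_le_iff₀ hs0]
    nlinarith
  have hB1 : B / R ≤ P := by rw [div_le_iff₀ hR0]; linarith
  have hBR0 : 0 ≤ B / R := by positivity
  refine ⟨?_, ?_, hzT2, ?_⟩
  · have h1 : A / s ≤ 1 := by rw [div_le_iff₀ hs0]; linarith
    have h2 : 1 / z * (A / s) ≤ 2 := by
      rw [div_mul_div_comm, one_mul, div_le_iff₀ (by positivity), ← hzs]; exact hA2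
    have h3 : (1 : ℝ) ≤ Real.sqrt 2 := Real.one_le_sqrt.2 (by norm_num)
    rw [add_mul, one_mul]; linarith
  · have h1 : 1 / z * (B / R) ≤ 8 := by
      rw [one_div_mul_eq_div, div_le_iff₀ hz0]
      rcases le_total (1 / 8) z with h8 | h8
      · linarith
      · have h4 := hRP (by rw [hzs]; nlinarith)
        have h5 : p * s ≤ z := by
          have : (p * s) * s ≤ z * s := by nlinarith
          exact le_of_mul_le_mul_right this hs0
        have h6 : p ≤ z := by linarith [mul_le_mul_of_nonneg_left hs1 hp]
        have h7 : R * P ≤ R * (4 * z + z * z + z) := by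
          have e1 : 2 * s * A ≤ R * (4 * z) := by
            rw [hzs] at hA2; rw [hRs]; linarith [mul_le_mul_of_nonneg_left hA2 hs0.le]
          have e2 : p * (n + 1 - R) ≤ z * z + z := by
            have : p * (n + 1 - R) = p * s * z + p := by linear_combination p * hzs
            rw [this]; linarith [mul_le_mul_of_nonneg_right h5 hz0.le]
          linarith [mul_le_mul_of_nonneg_left e2 hR0.le]
        have h9 := le_of_mul_le_mul_left h7 hR0
        linarith [mul_le_mul_of_nonneg_left h8 hz0.le]
    rw [add_mul, one_mul]; linarith
  · have e : ζ ^ 2 * T = p * (n - R) + p * (n - R) ^ 2 / R := by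
      have : ζ ^ 2 * T = z * (z * T) := by rw [hζz]; ring
      rw [this, hzT, hnps, hzs, hRs]; field_simp
    have e1 : p * (n - R) ^ 2 / R ≤ B / R := by gcongr
    rw [e]
    linarith
end
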